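/- Let X be a Banach space. If Γ : [0,1] → cwk(X) is ℋ-integrable, then Γ possesses at least one ℋ-integrable selection. If Γ : [0,1] → cwk(X) is both Pettis integrable and ℋ-integrable, then Γ possesses at least one Birkhoff integrable selection. -/

import Mathlib

open Set Metric MeasureTheory Pointwise
open scoped ENNReal NNReal

namespace GaugePaper

variable (X : Type*) [NormedAddCommGroup X] [NormedSpace ℝ X]

/-- `A ∈ cwk(X)`: `A` is a nonempty, convex and weakly compact subset of `X`. -/
def IsCWK (A : Set X) : Prop :=
  A.Nonempty ∧ Convex ℝ A ∧ IsCompact (toWeakSpace ℝ X '' A)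

variable {X}

/-- The support function `σ(x*, A)`. -/
noncomputable def suppFn (x' : X →L[ℝ] ℝ) (A : Set X) : ℝ := sSup (x' '' A)

/-- `‖A‖ = sup {‖x‖ : x ∈ A}`. -/
noncomputable def setNorm (A : Set X) : ℝ := sSup ((fun x => ‖x‖) '' A)

/-- A gauge on `[0,1]`: a positive function. -/
def IsGauge (δ : ℝ → ℝ) : Prop := ∀ t ∈ Icc (0:ℝ) 1, 0 < δ t

/-- A tagged partition of `[0,1]` into `n` (possibly degenerate) nonoverlapping closed
subintervals `[pt i, pt (i+1)]`, with tags `tag i ∈ [0,1]`. -/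
structure TP (n : ℕ) where
  pt : Fin (n + 1) → ℝ
  tag : Fin n → ℝ
  mono : Monotone pt
  first : pt 0 = 0
  last : pt (Fin.last n) = 1
  tagMem : ∀ i, tag i ∈ Icc (0:ℝ) 1

namespace TP

variable {n : ℕ} (P : TP n)

/-- The `i`-th subinterval of the partition. -/
def ivl (i : Fin n) : Set ℝ := Icc (P.pt i.castSucc) (P.pt i.succ)

/-- The length `|I_i|` of the `i`-th subinterval. -/
def len (i : Fin n) : ℝ := P.pt i.succ - P.pt i.castSucc

/-- A Perron (Henstock) partition: each tag belongs to its interval. -/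
def IsPerron : Prop := ∀ i, P.tag i ∈ P.ivl i

/-- `δ`-fineness: `I_i ⊆ (t_i - δ(t_i), t_i + δ(t_i))`. -/
def IsFine (δ : ℝ → ℝ) : Prop :=
  ∀ i, P.ivl i ⊆ Ioo (P.tag i - δ (P.tag i)) (P.tag i + δ (P.tag i))

/-- An interior Henstock partition: each tag is in the interior of its interval, except
possibly for intervals containing `0` or `1`, where the tag may also be `0` or `1`. -/
def IsInterior : Prop :=
  ∀ i, P.tag i ∈ Ioo (P.pt i.castSucc) (P.pt i.succ) ∨
    (((0:ℝ) ∈ P.ivl i ∨ (1:ℝ) ∈ P.ivl i) ∧ P.tag i ∈ P.ivl i ∩ ({0, 1} : Set ℝ))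

end TP

/-- Riemann sum of a multifunction: `∑ i |I_i| • Γ(t_i)` (Minkowski sums). -/
def mSum {n : ℕ} (P : TP n) (Γ : ℝ → Set X) : Set X :=
  ∑ i : Fin n, P.len i • Γ (P.tag i)

/-- Riemann sum of a function: `∑ i |I_i| • f(t_i)`. -/
def fSum {n : ℕ} (P : TP n) (f : ℝ → X) : X :=
  ∑ i : Fin n, P.len i • f (P.tag i)

/-! ### Gauge integrals of multifunctions -/

/-- Henstock integrability of a multifunction `Γ : [0,1] → cwk(X)`. -/
def HenstockIntegrable (Γ : ℝ → Set X) : Prop :=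
  ∃ I : Set X, IsCWK X I ∧ ∀ ε > 0, ∃ δ : ℝ → ℝ, IsGauge δ ∧
    ∀ (n : ℕ) (P : TP n), P.IsPerron → P.IsFine δ → hausdorffDist I (mSum P Γ) < ε

/-- McShane integrability of a multifunction (free tags). -/
def McShaneIntegrable (Γ : ℝ → Set X) : Prop :=
  ∃ I : Set X, IsCWK X I ∧ ∀ ε > 0, ∃ δ : ℝ → ℝ, IsGauge δ ∧
    ∀ (n : ℕ) (P : TP n), P.IsFine δ → hausdorffDist I (mSum P Γ) < ε

/-- `ℋ`-integrability: Henstock integrability with Lebesgue measurable gauges. -/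
def HMeasIntegrable (Γ : ℝ → Set X) : Prop :=
  ∃ I : Set X, IsCWK X I ∧ ∀ ε > 0, ∃ δ : ℝ → ℝ, IsGauge δ ∧ AEMeasurable δ volume ∧
    ∀ (n : ℕ) (P : TP n), P.IsPerron → P.IsFine δ → hausdorffDist I (mSum P Γ) < ε

/-- Birkhoff (`ℳ`-) integrability: McShane integrability with Lebesgue measurable gauges. -/
def BirkhoffIntegrable (Γ : ℝ → Set X) : Prop :=
  ∃ I : Set X, IsCWK X I ∧ ∀ ε > 0, ∃ δ : ℝ → ℝ, IsGauge δ ∧ AEMeasurable δ volume ∧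
    ∀ (n : ℕ) (P : TP n), P.IsFine δ → hausdorffDist I (mSum P Γ) < ε

/-! ### Gauge integrals of (single-valued) functions -/

/-- Henstock integrability of a function `f : [0,1] → X`. -/
def FHenstockIntegrable (f : ℝ → X) : Prop :=
  ∃ w : X, ∀ ε > 0, ∃ δ : ℝ → ℝ, IsGauge δ ∧
    ∀ (n : ℕ) (P : TP n), P.IsPerron → P.IsFine δ → ‖w - fSum P f‖ < ε

/-- McShane integrability of a function. -/
def FMcShaneIntegrable (f : ℝ → X) : Prop :=
  ∃ w : X, ∀ ε > 0, ∃ δ : ℝ → ℝ, IsGauge δ ∧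
    ∀ (n : ℕ) (P : TP n), P.IsFine δ → ‖w - fSum P f‖ < ε

/-- `ℋ`-integrability of a function: measurable gauges. -/
def FHMeasIntegrable (f : ℝ → X) : Prop :=
  ∃ w : X, ∀ ε > 0, ∃ δ : ℝ → ℝ, IsGauge δ ∧ AEMeasurable δ volume ∧
    ∀ (n : ℕ) (P : TP n), P.IsPerron → P.IsFine δ → ‖w - fSum P f‖ < ε

/-- Birkhoff (`ℳ`-) integrability of a function: McShane with measurable gauges. -/
def FBirkhoffIntegrable (f : ℝ → X) : Prop :=
  ∃ w : X, ∀ ε > 0, ∃ δ : ℝ → ℝ, IsGauge δ ∧ AEMeasurable δ volume ∧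
    ∀ (n : ℕ) (P : TP n), P.IsFine δ → ‖w - fSum P f‖ < ε

/-- Henstock–Kurzweil integrability of a real-valued function on `[0,1]`. -/
def HKIntegrable (g : ℝ → ℝ) : Prop :=
  ∃ A : ℝ, ∀ ε > 0, ∃ δ : ℝ → ℝ, IsGauge δ ∧
    ∀ (n : ℕ) (P : TP n), P.IsPerron → P.IsFine δ → |fSum P g - A| < ε

/-! ### Pettis integrals -/

/-- Pettis integrability of a function `f : [0,1] → X`. -/
def FPettisIntegrable (f : ℝ → X) : Prop :=
  (∀ x' : X →L[ℝ] ℝ, IntegrableOn (fun t => x' (f t)) (Icc (0:ℝ) 1) volume) ∧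
  ∀ E ⊆ Icc (0:ℝ) 1, NullMeasurableSet E volume →
    ∃ ν : X, ∀ x' : X →L[ℝ] ℝ, x' ν = ∫ t in E, x' (f t)

/-- Pettis integrability of a multifunction `Γ : [0,1] → cwk(X)`. -/
def PettisIntegrable (Γ : ℝ → Set X) : Prop :=
  (∀ x' : X →L[ℝ] ℝ, IntegrableOn (fun t => suppFn x' (Γ t)) (Icc (0:ℝ) 1) volume) ∧
  ∀ E ⊆ Icc (0:ℝ) 1, NullMeasurableSet E volume →
    ∃ W : Set X, IsCWK X W ∧ ∀ x' : X →L[ℝ] ℝ, suppFn x' W = ∫ t in E, suppFn x' (Γ t)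

/-- `f` is a selection of `Γ`. -/
def Selection (Γ : ℝ → Set X) (f : ℝ → X) : Prop := ∀ t ∈ Icc (0:ℝ) 1, f t ∈ Γ t

/-! ### Variational integrals -/

/-- Finite additivity of an interval multifunction on subintervals of `[0,1]`
(an interval `[a,b] ⊆ [0,1]` is encoded by its endpoints). -/
def AdditiveIntervalMF (Φ : ℝ → ℝ → Set X) : Prop :=
  ∀ a b c : ℝ, 0 ≤ a → a ≤ b → b ≤ c → c ≤ 1 → Φ a c = Φ a b + Φ b c

/-- Finite additivity of a vector-valued interval function on subintervals of `[0,1]`. -/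
def AdditiveIntervalF (Φ : ℝ → ℝ → X) : Prop :=
  ∀ a b c : ℝ, 0 ≤ a → a ≤ b → b ≤ c → c ≤ 1 → Φ a c = Φ a b + Φ b c

/-- `Φ` is a variational Henstock primitive of the multifunction `Γ`. -/
def vHPrimitive (Γ : ℝ → Set X) (Φ : ℝ → ℝ → Set X) : Prop :=
  (∀ a b : ℝ, 0 ≤ a → a ≤ b → b ≤ 1 → IsCWK X (Φ a b)) ∧ AdditiveIntervalMF Φ ∧
  ∀ ε > 0, ∃ δ : ℝ → ℝ, IsGauge δ ∧ ∀ (n : ℕ) (P : TP n), P.IsPerron → P.IsFine δ →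
    ∑ i : Fin n, hausdorffDist (Φ (P.pt i.castSucc) (P.pt i.succ)) (P.len i • Γ (P.tag i)) < ε

/-- Variational Henstock integrability of a multifunction. -/
def vHIntegrable (Γ : ℝ → Set X) : Prop := ∃ Φ : ℝ → ℝ → Set X, vHPrimitive Γ Φ

/-- Variational McShane integrability of a multifunction (free tags). -/
def vMSIntegrable (Γ : ℝ → Set X) : Prop :=
  ∃ Φ : ℝ → ℝ → Set X,
    (∀ a b : ℝ, 0 ≤ a → a ≤ b → b ≤ 1 → IsCWK X (Φ a b)) ∧ AdditiveIntervalMF Φ ∧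
    ∀ ε > 0, ∃ δ : ℝ → ℝ, IsGauge δ ∧ ∀ (n : ℕ) (P : TP n), P.IsFine δ →
      ∑ i : Fin n, hausdorffDist (Φ (P.pt i.castSucc) (P.pt i.succ)) (P.len i • Γ (P.tag i)) < ε

/-- Variational `ℋ`-integrability of a multifunction: measurable gauges. -/
def vHMeasIntegrable (Γ : ℝ → Set X) : Prop :=
  ∃ Φ : ℝ → ℝ → Set X,
    (∀ a b : ℝ, 0 ≤ a → a ≤ b → b ≤ 1 → IsCWK X (Φ a b)) ∧ AdditiveIntervalMF Φ ∧
    ∀ ε > 0, ∃ δ : ℝ → ℝ, IsGauge δ ∧ AEMeasurable δ volume ∧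
      ∀ (n : ℕ) (P : TP n), P.IsPerron → P.IsFine δ →
        ∑ i : Fin n, hausdorffDist (Φ (P.pt i.castSucc) (P.pt i.succ)) (P.len i • Γ (P.tag i)) < ε

/-- `Φ` is a variational Henstock primitive of the function `f`. -/
def FvHPrimitive (f : ℝ → X) (Φ : ℝ → ℝ → X) : Prop :=
  AdditiveIntervalF Φ ∧
  ∀ ε > 0, ∃ δ : ℝ → ℝ, IsGauge δ ∧ ∀ (n : ℕ) (P : TP n), P.IsPerron → P.IsFine δ →
    ∑ i : Fin n, ‖Φ (P.pt i.castSucc) (P.pt i.succ) - P.len i • f (P.tag i)‖ < ε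

/-- Variational Henstock integrability of a function. -/
def FvHIntegrable (f : ℝ → X) : Prop := ∃ Φ : ℝ → ℝ → X, FvHPrimitive f Φ

/-- Variational McShane integrability of a function (free tags). -/
def FvMSIntegrable (f : ℝ → X) : Prop :=
  ∃ Φ : ℝ → ℝ → X, AdditiveIntervalF Φ ∧
    ∀ ε > 0, ∃ δ : ℝ → ℝ, IsGauge δ ∧ ∀ (n : ℕ) (P : TP n), P.IsFine δ →
      ∑ i : Fin n, ‖Φ (P.pt i.castSucc) (P.pt i.succ) - P.len i • f (P.tag i)‖ < ε

/-- Variational `ℋ`-integrability of a function: measurable gauges. -/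
def FvHMeasIntegrable (f : ℝ → X) : Prop :=
  ∃ Φ : ℝ → ℝ → X, AdditiveIntervalF Φ ∧
    ∀ ε > 0, ∃ δ : ℝ → ℝ, IsGauge δ ∧ AEMeasurable δ volume ∧
      ∀ (n : ℕ) (P : TP n), P.IsPerron → P.IsFine δ →
        ∑ i : Fin n, ‖Φ (P.pt i.castSucc) (P.pt i.succ) - P.len i • f (P.tag i)‖ < ε

/-! ### Partial Perron partitions and variational measures -/

/-- A finite tagged Perron family of `n` nonoverlapping closed subintervals
`[a i, b i]` of `[0,1]` (a "partition in `[0,1]`", not necessarily covering it). -/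
structure PTP (n : ℕ) where
  a : Fin n → ℝ
  b : Fin n → ℝ
  tag : Fin n → ℝ
  le : ∀ i, a i ≤ b i
  sub : ∀ i, Icc (a i) (b i) ⊆ Icc (0:ℝ) 1
  nonoverlap : ∀ i j, i ≠ j → (Icc (a i) (b i) ∩ Icc (a j) (b j)).Subsingleton
  perron : ∀ i, tag i ∈ Icc (a i) (b i)

/-- `δ`-fineness of a partial Perron family. -/
def PTP.IsFine {n : ℕ} (P : PTP n) (δ : ℝ → ℝ) : Prop :=
  ∀ i, Icc (P.a i) (P.b i) ⊆ Ioo (P.tag i - δ (P.tag i)) (P.tag i + δ (P.tag i))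

/-- `Var(Ψ, δ, E)` for a scalar interval function `Ψ`. -/
noncomputable def scVar (Ψ : ℝ → ℝ → ℝ) (δ : ℝ → ℝ) (E : Set ℝ) : ℝ≥0∞ :=
  ⨆ (n : ℕ) (P : PTP n) (_ : P.IsFine δ ∧ ∀ i, P.tag i ∈ E),
    ∑ i : Fin n, ENNReal.ofReal |Ψ (P.a i) (P.b i)|

/-- The variational measure `V_Ψ(E)` generated by a scalar interval function `Ψ`. -/
noncomputable def scVarMeasure (Ψ : ℝ → ℝ → ℝ) (E : Set ℝ) : ℝ≥0∞ :=
  ⨅ (δ : ℝ → ℝ) (_ : IsGauge δ), scVar Ψ δ E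


/-! ### Strongly exposed points of weakly compact convex sets -/

theorem isClosed_of_isCompact_weak {K : Set X} (hK : IsCompact (toWeakSpace ℝ X '' K)) :
    IsClosed K := by
  have h : K = toWeakSpaceCLM ℝ X ⁻¹' (toWeakSpace ℝ X '' K) := by
    ext x
    simp [toWeakSpaceCLM_eq_toWeakSpace]
  rw [h]
  exact hK.isClosed.preimage (toWeakSpaceCLM ℝ X).continuous

theorem continuous_weak_eval (y : X →L[ℝ] ℝ) :
    Continuous fun x : WeakSpace ℝ X => y ((toWeakSpace ℝ X).symm x) :=
  WeakBilin.eval_continuous (topDualPairing ℝ X).flip y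

theorem isCompact_weak_of_subset {K S : Set X} (hK : IsCompact (toWeakSpace ℝ X '' K))
    (hSK : S ⊆ K) (hS : IsClosed S) (hc : Convex ℝ S) : IsCompact (toWeakSpace ℝ X '' S) := by
  refine hK.of_isClosed_subset ?_ (image_mono hSK)
  have := hc.toWeakSpace_closure ℝ
  rw [hS.closure_eq] at this
  rw [this]
  exact isClosed_closure

/-- A functional attains its maximum on a nonempty weakly compact set. -/
theorem exists_forall_dual_le {K : Set X} (hK : IsCompact (toWeakSpace ℝ X '' K))
    (hne : K.Nonempty) (y : X →L[ℝ] ℝ) : ∃ z ∈ K, ∀ k ∈ K, y k ≤ y z := by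
  obtain ⟨_, ⟨z, hz, rfl⟩, h⟩ := hK.exists_isMaxOn (hne.image _)
    (continuous_weak_eval y).continuousOn
  refine ⟨z, hz, fun k hk => ?_⟩
  simpa using h (mem_image_of_mem _ hk)

theorem exists_norm_le_of_isCompact_weak {K : Set X}
    (hK : IsCompact (toWeakSpace ℝ X '' K)) : ∃ M > 0, ∀ x ∈ K, ‖x‖ ≤ M := by
  rcases K.eq_empty_or_nonempty with rfl | hne
  · exact ⟨1, one_pos, by simp⟩
  obtain ⟨C, hC⟩ := banach_steinhaus
    (g := fun k : K => NormedSpace.inclusionInDoubleDual ℝ X k) (fun y => by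
      obtain ⟨z, _, hz⟩ := exists_forall_dual_le hK hne y
      obtain ⟨z', _, hz'⟩ := exists_forall_dual_le hK hne (-y)
      refine ⟨max (y z) ((-y) z'), fun k => ?_⟩
      rw [NormedSpace.dual_def, Real.norm_eq_abs, abs_le']
      exact ⟨(hz k k.2).trans (le_max_left _ _), (hz' k k.2).trans (le_max_right _ _)⟩)
  refine ⟨max C 1, by positivity, fun x hx => ?_⟩
  refine NormedSpace.norm_le_dual_bound ℝ x (by positivity) fun f => ?_
  have h1 := (NormedSpace.inclusionInDoubleDual ℝ X x).le_opNorm f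
  rw [NormedSpace.dual_def] at h1
  exact h1.trans (mul_le_mul_of_nonneg_right ((hC ⟨x, hx⟩).trans (le_max_left _ _))
    (norm_nonneg f))

/-- If all functionals near `w` attain their maximum on `K` at a point of a ball, then thin
slices of `K` determined by `w` lie in any larger concentric ball. -/
theorem exists_slice_subset {K : Set X} {w : X →L[ℝ] ℝ} {b : X} {ρ r η : ℝ} (hη : 0 < η)
    (hρ : ρ < r) (h : ∀ w' : X →L[ℝ] ℝ, ‖w' - w‖ < η →
      ∃ z ∈ K, ‖z - b‖ ≤ ρ ∧ ∀ k ∈ K, w' k ≤ w' z) :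
    ∃ α > 0, ∀ z ∈ K, (∀ k ∈ K, w k - α < w z) → ‖z - b‖ ≤ r := by
  refine ⟨η / 2 * (r - ρ), by have := sub_pos.2 hρ; positivity, fun z hz hzα => ?_⟩
  by_contra! hr
  obtain ⟨g, hg1, hg⟩ := exists_dual_vector'' ℝ (z - b)
  obtain ⟨z', hz', hzb, hmax⟩ := h (w + (η / 2) • g) (by
    rw [add_sub_cancel_left, norm_smul, Real.norm_of_nonneg (by positivity)]
    nlinarith)
  have h1 := hmax z hz
  have h2 := hzα z' hz'
  have h3 : g (z' - b) ≤ ρ :=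
    (le_abs_self _).trans ((g.le_opNorm _).trans (by
      nlinarith [norm_nonneg (z' - b), norm_nonneg g]))
  simp only [add_apply, smul_apply, smul_eq_mul] at h1
  simp only [map_sub, RCLike.ofReal_real_eq_id, id] at hg h3
  nlinarith

/-- A separable weakly compact convex set has slices of small diameter. -/
theorem exists_small_slice_of_isSeparable {S : Set X} (hS : IsCompact (toWeakSpace ℝ X '' S))
    (hc : Convex ℝ S) (hne : S.Nonempty) (hsep : TopologicalSpace.IsSeparable S) {ε : ℝ}
    (hε : 0 < ε) : ∃ (y : X →L[ℝ] ℝ) (b : X), ∃ α > 0, ∀ z ∈ S,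
      (∀ k ∈ S, y k - α < y z) → ‖z - b‖ ≤ ε := by
  obtain ⟨c, hcc, hSc⟩ := hsep
  obtain ⟨M, hM0, hM⟩ := exists_norm_le_of_isCompact_weak hS
  have hScl := isClosed_of_isCompact_weak hS
  let C : c → Set (X →L[ℝ] ℝ) := fun b => {y | ∃ z ∈ S, ‖z - b‖ ≤ ε / 2 ∧ ∀ k ∈ S, y k ≤ y z}
  have hclosed : ∀ b, IsClosed (C b) := by
    intro b
    rw [← isOpen_compl_iff, Metric.isOpen_iff]
    intro y hy
    rcases (S ∩ closedBall (b : X) (ε / 2)).eq_empty_or_nonempty with he | hne'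
    · refine ⟨1, one_pos, fun y' _ hy' => ?_⟩
      obtain ⟨z, hz, hzb, -⟩ := hy'
      have : z ∈ S ∩ closedBall (b : X) (ε / 2) := ⟨hz, by simpa [dist_eq_norm] using hzb⟩
      simp [he] at this
    · obtain ⟨z₀, hz₀, hmax⟩ := exists_forall_dual_le
        (isCompact_weak_of_subset hS inter_subset_left (hScl.inter isClosed_closedBall)
          (hc.inter (convex_closedBall _ _))) hne' y
      have : ∃ k ∈ S, y z₀ < y k := by
        by_contra! hcon
        exact hy ⟨z₀, hz₀.1, by simpa [dist_eq_norm] using hz₀.2, hcon⟩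
      obtain ⟨k, hk, hlt⟩ := this
      refine ⟨(y k - y z₀) / (2 * M), by have := sub_pos.2 hlt; positivity, ?_⟩
      rintro y' hy' ⟨z, hz, hzb, hmax'⟩
      have h1 := hmax z ⟨hz, by simpa [dist_eq_norm] using hzb⟩
      have h2 := hmax' k hk
      rw [mem_ball, dist_eq_norm, lt_div_iff₀ (by positivity)] at hy'
      have h3 : |(y' - y) (k - z)| ≤ ‖y' - y‖ * (2 * M) :=
        ((y' - y).le_opNorm _).trans (mul_le_mul_of_nonneg_left
          ((norm_sub_le _ _).trans (by linarith [hM k hk, hM z hz])) (norm_nonneg _))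
      have h4 := (abs_le.1 h3).1
      simp only [sub_apply, map_sub] at h4
      linarith
  have hunion : ⋃ b, C b = univ := by
    refine eq_univ_of_forall fun y => ?_
    obtain ⟨z, hz, hmax⟩ := exists_forall_dual_le hS hne y
    obtain ⟨b, hb, hzb⟩ := Metric.mem_closure_iff.1 (hSc hz) (ε / 2) (by positivity)
    exact mem_iUnion.2 ⟨⟨b, hb⟩, z, hz, by rw [← dist_eq_norm]; exact hzb.le, hmax⟩
  have := hcc.to_subtype
  obtain ⟨b, y, hy⟩ := nonempty_interior_of_iUnion_of_closed hclosed hunion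
  obtain ⟨η, hη, hball⟩ := Metric.isOpen_iff.1 isOpen_interior y hy
  obtain ⟨α, hα, h⟩ := exists_slice_subset (K := S) (b := b) (ρ := ε / 2) (r := ε) hη
    (by linarith) fun w' hw' => by
      have hw : w' ∈ C b := interior_subset (hball (by simpa [dist_eq_norm] using hw'))
      exact hw
  exact ⟨y, b, α, hα, h⟩

theorem exists_countable_mem_closure_convexHull {s : Set X} {x : X}
    (hx : x ∈ closure (convexHull ℝ s)) :
    ∃ A ⊆ s, A.Countable ∧ x ∈ closure (convexHull ℝ A) := by
  obtain ⟨u, hu, hlim⟩ := mem_closure_iff_seq_limit.1 hx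
  have : ∀ n, ∃ F : Finset X, ↑F ⊆ s ∧ u n ∈ convexHull ℝ (F : Set X) := fun n => by
    have := hu n
    rw [convexHull_eq_union_convexHull_finite_subsets] at this
    simpa using this
  choose F hF hu' using this
  refine ⟨⋃ n, F n, iUnion_subset hF, countable_iUnion fun n => (F n).countable_toSet, ?_⟩
  exact mem_closure_of_tendsto hlim (Filter.Eventually.of_forall fun n =>
    convexHull_mono (subset_iUnion (fun n => (F n : Set X)) n) (hu' n))

/-- Every nonempty subset of a weakly compact convex set is dentable. -/
theorem exists_dent {K D : Set X} (hK : IsCompact (toWeakSpace ℝ X '' K)) (hc : Convex ℝ K)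
    (hDK : D ⊆ K) (hne : D.Nonempty) {ε : ℝ} (hε : 0 < ε) :
    ∃ (g : X →L[ℝ] ℝ) (c : ℝ) (b : X), (∃ x ∈ D, c < g x) ∧ ∀ x ∈ D, c < g x → ‖x - b‖ ≤ ε := by
  by_contra! hcon
  have key : ∀ x ∈ D, ∃ A ⊆ D \ closedBall x ε, A.Countable ∧ x ∈ closure (convexHull ℝ A) := by
    intro x hx
    refine exists_countable_mem_closure_convexHull ?_
    by_contra hx'
    obtain ⟨g, u, h1, h2⟩ := geometric_hahn_banach_closed_point (convex_convexHull ℝ _).closure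
      isClosed_closure hx'
    obtain ⟨x', hx'D, hux', hlt⟩ := hcon g u x ⟨x, hx, h2⟩
    have := h1 x' (subset_closure (subset_convexHull ℝ _ ⟨hx'D, by
      simpa [dist_eq_norm] using hlt⟩))
    linarith
  choose! A hAD hAc hA using key
  obtain ⟨x₀, hx₀⟩ := hne
  let E : ℕ → Set X := fun n => Nat.rec {x₀} (fun _ s => ⋃ x ∈ s, A x) n
  have hE : ∀ n, E n ⊆ D ∧ (E n).Countable := by
    intro n
    induction n with
    | zero => exact ⟨by simpa [E] using hx₀, countable_singleton _⟩
    | succ n ih =>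
      refine ⟨iUnion₂_subset fun x hx => (hAD x (ih.1 hx)).trans sdiff_subset, ?_⟩
      exact ih.2.biUnion fun x hx => hAc x (ih.1 hx)
  let D₀ : Set X := ⋃ n, E n
  have hD₀D : D₀ ⊆ D := iUnion_subset fun n => (hE n).1
  have hD₀c : D₀.Countable := countable_iUnion fun n => (hE n).2
  have hAD₀ : ∀ x ∈ D₀, A x ⊆ D₀ := by
    intro x hx
    obtain ⟨n, hn⟩ := mem_iUnion.1 hx
    exact (subset_iUnion₂ (s := fun x (_ : x ∈ E n) => A x) x hn).trans
      (subset_iUnion E (n + 1))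
  have hx₀D₀ : x₀ ∈ D₀ := mem_iUnion.2 ⟨0, mem_singleton _⟩
  let S : Set X := closure (convexHull ℝ D₀)
  have hD₀S : D₀ ⊆ S := (subset_convexHull ℝ _).trans subset_closure
  have hSK : S ⊆ K :=
    closure_minimal (convexHull_min (hD₀D.trans hDK) hc) (isClosed_of_isCompact_weak hK)
  have hSconv : Convex ℝ S := (convex_convexHull ℝ _).closure
  have hSw := isCompact_weak_of_subset hK hSK isClosed_closure hSconv
  have hSsep : TopologicalSpace.IsSeparable S := by
    refine (((hD₀c.isSeparable).span (R := ℝ)).mono ?_).closure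
    exact convexHull_min Submodule.subset_span (Submodule.convex _)
  obtain ⟨y, b, α, hα, hslice⟩ := exists_small_slice_of_isSeparable hSw hSconv
    ⟨x₀, hD₀S hx₀D₀⟩ hSsep (half_pos hε)
  obtain ⟨z, hz, hmax⟩ := exists_forall_dual_le hSw ⟨x₀, hD₀S hx₀D₀⟩ y
  have hhalf : ∀ B : Set X, (∀ a ∈ B, y a ≤ y z - α) →
      ∀ x ∈ closure (convexHull ℝ B), y x ≤ y z - α := by
    intro B hB x hx
    have : closure (convexHull ℝ B) ⊆ {x | y x ≤ y z - α} :=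
      closure_minimal (convexHull_min hB (convex_halfSpace_le y.toLinearMap.isLinear _))
        (isClosed_le y.continuous continuous_const)
    exact this hx
  have hin : ∀ a ∈ D₀, y z - α < y a → ‖a - b‖ ≤ ε / 2 := fun a ha hlt =>
    hslice a (hD₀S ha) fun k hk => by linarith [hmax k hk]
  have : ∃ x ∈ D₀, y z - α < y x := by
    by_contra! h
    have := hhalf D₀ h z hz
    linarith
  obtain ⟨x, hx, hxα⟩ := this
  have := hhalf (A x) (fun a ha => by
    by_contra! hlt
    refine (hAD x (hD₀D hx) ha).2 ?_
    rw [mem_closedBall, dist_eq_norm]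
    have h1 := hin a (hAD₀ x hx ha) hlt
    have h2 := hin x hx hxα
    have h3 := norm_sub_le (a - b) (x - b)
    rw [sub_sub_sub_cancel_right] at h3
    linarith) x (hA x (hD₀D hx))
  linarith

/-- A weakly compact convex set has a strongly exposed point. -/
theorem exists_stronglyExposed {I : Set X} (hI : IsCWK X I) :
    ∃ x₀ ∈ I, ∃ y : X →L[ℝ] ℝ, ∀ ε > 0, ∃ α > 0, ∀ z ∈ I, y x₀ - α < y z → ‖z - x₀‖ ≤ ε := by
  obtain ⟨hne, hc, hw⟩ := hI
  obtain ⟨M, hM0, hM⟩ := exists_norm_le_of_isCompact_weak hw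
  have hdiff : ∀ (u : X →L[ℝ] ℝ), ∀ a ∈ I, ∀ b ∈ I, u (a - b) ≤ ‖u‖ * (2 * M) := by
    intro u a ha b hb
    refine (le_abs_self _).trans ((u.le_opNorm _).trans (mul_le_mul_of_nonneg_left
      ((norm_sub_le _ _).trans (by linarith [hM a ha, hM b hb])) (norm_nonneg _)))
  let G : ℕ → Set (X →L[ℝ] ℝ) := fun n => {y | ∃ b : X, ∃ α > 0, ∀ z ∈ I,
    (∀ k ∈ I, y k - α < y z) → ‖z - b‖ ≤ 1 / (n + 1)}
  have hopen : ∀ n, IsOpen (G n) := by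
    intro n
    rw [Metric.isOpen_iff]
    rintro y ⟨b, α, hα, h⟩
    refine ⟨α / 2 / (2 * M), by positivity, fun y' hy' => ⟨b, α / 2, by positivity, ?_⟩⟩
    intro z hz hz'
    rw [mem_ball', dist_eq_norm, lt_div_iff₀ (by positivity)] at hy'
    refine h z hz fun k hk => ?_
    have h1 := hdiff (y - y') k hk z hz
    have h2 := hz' k hk
    simp only [sub_apply, map_sub] at h1
    linarith
  choose f hfI hfmax using fun y : X →L[ℝ] ℝ => exists_forall_dual_le hw hne y
  have hdense : ∀ n, Dense (G n) := by
    intro n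
    rw [Metric.dense_iff]
    intro y₀ s hs
    obtain ⟨g, c, b, ⟨x, ⟨y, hy, rfl⟩, hcx⟩, hsmall⟩ := exists_dent hw hc (D := f '' ball y₀ s)
      (by rintro _ ⟨y, -, rfl⟩; exact hfI y) ((nonempty_ball.2 hs).image f)
      (ε := 1 / (n + 1) / 2) (by positivity)
    have hcont : Filter.Tendsto (fun t : ℝ => y + t • g) (nhdsWithin 0 (Ioi 0)) (nhds y) := by
      have : Continuous fun t : ℝ => y + t • g := by fun_prop
      simpa using this.continuousWithinAt (s := Ioi 0) (x := 0) |>.tendsto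
    obtain ⟨t, ht, ht0⟩ := ((hcont.eventually (isOpen_ball.mem_nhds hy)).and
      self_mem_nhdsWithin).exists
    obtain ⟨η, hη, hball⟩ := Metric.isOpen_iff.1 isOpen_ball _ ht
    refine ⟨y + t • g, ht, b, ?_⟩
    have hgap := sub_pos.2 hcx
    refine exists_slice_subset (η := min η (t * (g (f y) - c) / (2 * M))) (by positivity)
      (half_lt_self (by positivity)) fun w' hw' => ⟨f w', hfI w', ?_, hfmax w'⟩
    rw [lt_min_iff, lt_div_iff₀ (by positivity)] at hw'
    refine hsmall _ (mem_image_of_mem _ (hball (by simpa [dist_eq_norm] using hw'.1))) ?_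
    have h1 := hfmax w' _ (hfI y)
    have h2 := hfmax y _ (hfI w')
    have h3 := hdiff (w' - (y + t • g)) _ (hfI w') _ (hfI y)
    simp only [sub_apply, add_apply,
      smul_apply, map_sub, smul_eq_mul] at h3
    have h4 : t * c < t * g (f w') := by linarith [hw'.2]
    exact lt_of_mul_lt_mul_left h4 ht0.le
  obtain ⟨y, hy⟩ := (dense_iInter_of_isOpen_nat hopen hdense).nonempty
  refine ⟨f y, hfI y, y, fun ε hε => ?_⟩
  obtain ⟨n, hn⟩ := exists_nat_one_div_lt (half_pos hε)
  obtain ⟨b, α, hα, h⟩ := mem_iInter.1 hy n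
  refine ⟨α, hα, fun z hz hlt => ?_⟩
  have h1 := h z hz fun k hk => by linarith [hfmax y k hk]
  have h2 := h (f y) (hfI y) fun k hk => by linarith [hfmax y k hk]
  have h3 := norm_sub_le (z - b) (f y - b)
  rw [sub_sub_sub_cancel_right] at h3
  linarith

/-! ### An `ℋ`-integrable selection -/

theorem fSum_mem_mSum {n : ℕ} (P : TP n) {Γ : ℝ → Set X} {f : ℝ → X}
    (hf : Selection Γ f) : fSum P f ∈ mSum P Γ := by
  rw [mSum, fSum, Set.mem_finsetSum]
  exact ⟨_, fun {i} _ => smul_mem_smul_set (hf _ (P.tagMem i)), rfl⟩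

theorem TP.len_nonneg {n : ℕ} (P : TP n) (i : Fin n) : 0 ≤ P.len i :=
  sub_nonneg.2 (P.mono i.castSucc_lt_succ.le)

theorem dual_le_of_mem_mSum {n : ℕ} (P : TP n) {Γ : ℝ → Set X} {f : ℝ → X} {y : X →L[ℝ] ℝ}
    (hf : ∀ t ∈ Icc (0:ℝ) 1, ∀ z ∈ Γ t, y z ≤ y (f t)) {z : X} (hz : z ∈ mSum P Γ) :
    y z ≤ y (fSum P f) := by
  rw [mSum, Set.mem_finsetSum] at hz
  obtain ⟨g, hg, rfl⟩ := hz
  rw [fSum, map_sum, map_sum]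
  refine Finset.sum_le_sum fun i _ => ?_
  obtain ⟨v, hv, hv'⟩ := hg (Finset.mem_univ i)
  rw [← hv']
  simp only [map_smul, smul_eq_mul]
  exact mul_le_mul_of_nonneg_left (hf _ (P.tagMem i) _ hv) (P.len_nonneg i)

theorem isBounded_mSum {n : ℕ} (P : TP n) {Γ : ℝ → Set X}
    (hΓ : ∀ t ∈ Icc (0:ℝ) 1, IsCWK X (Γ t)) : Bornology.IsBounded (mSum P Γ) := by
  have h : ∀ i, ∃ M > 0, ∀ x ∈ Γ (P.tag i), ‖x‖ ≤ M := fun i =>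
    exists_norm_le_of_isCompact_weak (hΓ _ (P.tagMem i)).2.2
  choose M hM0 hM using h
  refine isBounded_iff_forall_norm_le.2 ⟨∑ i, P.len i * M i, fun z hz => ?_⟩
  rw [mSum, Set.mem_finsetSum] at hz
  obtain ⟨g, hg, rfl⟩ := hz
  refine norm_sum_le_of_le _ fun i _ => ?_
  obtain ⟨v, hv, hv'⟩ := hg (Finset.mem_univ i)
  rw [← hv']
  simp only [norm_smul, Real.norm_of_nonneg (P.len_nonneg i)]
  exact mul_le_mul_of_nonneg_left (hM i v hv) (P.len_nonneg i)

/-- Selecting in each `Γ t` a maximizer of a functional which strongly exposes the integral of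
`Γ` yields an `ℋ`-integrable selection. -/
theorem exists_selection_fHMeasIntegrable [CompleteSpace X] {Γ : ℝ → Set X}
    (hΓ : ∀ t ∈ Icc (0:ℝ) 1, IsCWK X (Γ t)) (h : HMeasIntegrable Γ) :
    ∃ f : ℝ → X, Selection Γ f ∧ FHMeasIntegrable f := by
  obtain ⟨I, hI, hint⟩ := h
  obtain ⟨x₀, hx₀, y, hy⟩ := exists_stronglyExposed hI
  have hsel : ∀ t, ∃ z, t ∈ Icc (0:ℝ) 1 → z ∈ Γ t ∧ ∀ k ∈ Γ t, y k ≤ y z := fun t => by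
    by_cases ht : t ∈ Icc (0:ℝ) 1
    · obtain ⟨z, hz, hmax⟩ := exists_forall_dual_le (hΓ t ht).2.2 (hΓ t ht).1 y
      exact ⟨z, fun _ => ⟨hz, hmax⟩⟩
    · exact ⟨0, fun h => absurd h ht⟩
  choose f hf using hsel
  have hfs : Selection Γ f := fun t ht => (hf t ht).1
  refine ⟨f, hfs, x₀, fun ε hε => ?_⟩
  obtain ⟨α, hα, hexp⟩ := hy (ε / 2) (by positivity)
  set ε' := min (ε / 2) (α / (2 * (‖y‖ + 1))) with hε'
  have hε0 : 0 < ε' := by positivity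
  obtain ⟨δ, hδ, hδm, hfine⟩ := hint ε' hε0
  refine ⟨δ, hδ, hδm, fun n P hP hPδ => ?_⟩
  have hd := hfine n P hP hPδ
  have hfin : hausdorffEDist I (mSum P Γ) ≠ ⊤ := by
    obtain ⟨M, -, hM⟩ := exists_norm_le_of_isCompact_weak hI.2.2
    exact hausdorffEDist_ne_top_of_nonempty_of_bounded hI.1 ⟨_, fSum_mem_mSum P hfs⟩
      (isBounded_iff_forall_norm_le.2 ⟨M, hM⟩) (isBounded_mSum P hΓ)
  obtain ⟨z, hz, hxz⟩ := exists_dist_lt_of_hausdorffDist_lt hx₀ hd hfin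
  obtain ⟨k, hk, hkf⟩ := exists_dist_lt_of_hausdorffDist_lt' (fSum_mem_mSum P hfs) hd hfin
  rw [dist_eq_norm] at hxz hkf
  have hzf := dual_le_of_mem_mSum P (fun t ht => (hf t ht).2) hz
  have hle : ∀ v : X, ‖v‖ < ε' → y v < α / 2 := fun v hv => by
    refine ((le_abs_self _).trans (y.le_opNorm v)).trans_lt ?_
    have h1 : ‖v‖ < α / (2 * (‖y‖ + 1)) := hv.trans_le (min_le_right _ _)
    rw [lt_div_iff₀ (by positivity)] at h1
    nlinarith [norm_nonneg v, norm_nonneg y]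
  have h1 := hle _ hxz
  have h2 := hle (fSum P f - k) (by rw [norm_sub_rev]; exact hkf)
  rw [map_sub] at h1 h2
  have h3 := hexp k hk (by linarith)
  calc ‖x₀ - fSum P f‖ = ‖(k - fSum P f) - (k - x₀)‖ := by congr 1; abel
    _ ≤ ‖k - fSum P f‖ + ‖k - x₀‖ := norm_sub_le _ _
    _ < ε := by linarith [hkf.trans_le (min_le_left (ε / 2) _)]

/-! ### Weakly compact domination and a subseries theorem -/

theorem le_suppFn {K : Set X} (hK : IsCompact (toWeakSpace ℝ X '' K)) (y : X →L[ℝ] ℝ) {z : X}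
    (hz : z ∈ K) : y z ≤ suppFn y K := by
  obtain ⟨w, -, hmax⟩ := exists_forall_dual_le hK ⟨z, hz⟩ y
  refine le_csSup ⟨y w, ?_⟩ (mem_image_of_mem _ hz)
  rintro _ ⟨k, hk, rfl⟩
  exact hmax k hk

open Classical in
/-- A linear functional on the dual which is dominated by the support function of a convex
weakly compact set is evaluation at a point of that set. -/
theorem exists_eq_eval_of_le_suppFn {W : Set X} (hW : IsCWK X W) (L : (X →L[ℝ] ℝ) →ₗ[ℝ] ℝ)
    (hL : ∀ y, L y ≤ suppFn y W) : ∃ z ∈ W, ∀ y : X →L[ℝ] ℝ, y z = L y := by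
  have key := hW.2.2.inter_iInter_nonempty
    (fun y : X →L[ℝ] ℝ => {x : WeakSpace ℝ X | y ((toWeakSpace ℝ X).symm x) = L y})
    (fun y => isClosed_eq (continuous_weak_eval y) continuous_const) (fun u => by
      let T : X →ₗ[ℝ] (u → ℝ) := LinearMap.pi fun i => (i : X →L[ℝ] ℝ).toLinearMap
      have hcl : IsClosed (T '' W) := by
        have : T '' W = (fun x : WeakSpace ℝ X => T ((toWeakSpace ℝ X).symm x)) ''
            (toWeakSpace ℝ X '' W) := by
          rw [image_image]
          simp
        rw [this]
        refine (hW.2.2.image ?_).isClosed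
        exact continuous_pi fun i => continuous_weak_eval (i : X →L[ℝ] ℝ)
      by_cases hmem : (fun i : u => L i) ∈ T '' W
      · obtain ⟨z, hz, hzL⟩ := hmem
        refine ⟨toWeakSpace ℝ X z, mem_image_of_mem _ hz, mem_iInter₂.2 fun y hy => ?_⟩
        have := congrFun hzL ⟨y, hy⟩
        simpa [T] using this
      · exfalso
        obtain ⟨g, c, hg1, hg2⟩ :=
          geometric_hahn_banach_closed_point (hW.2.1.linear_image T) hcl hmem
        have hgsum : ∀ a : u → ℝ, g a = ∑ i, a i * g (Pi.single i 1) := fun a => by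
          conv_lhs => rw [← Finset.univ_sum_single a]
          rw [map_sum]
          refine Finset.sum_congr rfl fun i _ => ?_
          have : (Pi.single i (a i) : u → ℝ) = a i • Pi.single i 1 := by
            rw [← Pi.single_smul]; simp
          rw [this, map_smul, smul_eq_mul]
        let y : X →L[ℝ] ℝ := ∑ i : u, g (Pi.single i 1) • (i : X →L[ℝ] ℝ)
        have hyL : L y = g fun i => L i := by
          rw [hgsum]
          simp [y, mul_comm]
        have hyz : ∀ z, y z = g (T z) := fun z => by
          rw [hgsum]
          simp [y, T, mul_comm]
        have hsup : suppFn y W ≤ c := by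
          refine csSup_le (hW.1.image _) ?_
          rintro _ ⟨z, hz, rfl⟩
          rw [hyz]
          exact (hg1 _ (mem_image_of_mem _ hz)).le
        have := hL y
        rw [hyL] at this
        linarith)
  obtain ⟨_, ⟨z, hz, rfl⟩, hzL⟩ := key
  refine ⟨z, hz, fun y => ?_⟩
  simpa using mem_iInter.1 hzL y

/-- A weakly subseries convergent series has arbitrarily small terms. -/
theorem exists_norm_le_of_weak_subseries {v : ℕ → X} {φ : (ℕ → Bool) → X}
    (hv : ∀ y : X →L[ℝ] ℝ, Summable fun k => |y (v k)|)
    (hφ : ∀ (y : X →L[ℝ] ℝ) (ω : ℕ → Bool), y (φ ω) = ∑' k, if ω k then y (v k) else 0)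
    {ε : ℝ} (hε : 0 < ε) : ∃ k, ‖v k‖ ≤ ε := by
  have hsep : TopologicalSpace.IsSeparable (closure (Submodule.span ℝ (range v) : Set X)) :=
    ((countable_range v).isSeparable.span (R := ℝ)).closure
  have hmem : ∀ ω, φ ω ∈ closure (Submodule.span ℝ (range v) : Set X) := by
    intro ω
    by_contra hcon
    obtain ⟨y, c, hy1, hy2⟩ := geometric_hahn_banach_closed_point
      (Submodule.span ℝ (range v)).convex.closure isClosed_closure hcon
    have hzero : ∀ k, y (v k) = 0 := fun k => by
      by_contra hne
      have := hy1 _ (subset_closure ((Submodule.span ℝ (range v)).smul_mem (c / y (v k))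
        (Submodule.subset_span (mem_range_self k))))
      rw [map_smul, smul_eq_mul, div_mul_cancel₀ _ hne] at this
      exact lt_irrefl _ this
    have h0 := hy1 0 (subset_closure (Submodule.zero_mem _))
    rw [hφ] at hy2
    simp [hzero] at hy2 h0
    linarith
  obtain ⟨c, hcc, hc⟩ := hsep
  have hcont : ∀ y : X →L[ℝ] ℝ, Continuous fun ω => y (φ ω) := fun y => by
    simp only [hφ]
    refine continuous_tsum (fun k => ?_) (hv y) fun k ω => ?_
    · exact (continuous_of_discreteTopology (f := fun b : Bool => if b then y (v k) else 0)).comp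
        (continuous_apply k)
    · split_ifs <;> simp
  let C : c → Set (ℕ → Bool) := fun b => {ω | ‖φ ω - b‖ ≤ ε / 2}
  have hclosed : ∀ b, IsClosed (C b) := fun b => by
    have : C b = ⋂ (y : X →L[ℝ] ℝ) (_ : ‖y‖ ≤ 1), {ω | y (φ ω) - y b ≤ ε / 2} := by
      ext ω
      simp only [C, mem_ofPred_eq, mem_iInter]
      constructor
      · intro h y hy
        rw [← map_sub]
        exact (le_abs_self _).trans ((y.le_of_opNorm_le hy _).trans (by rwa [one_mul]))
      · intro h
        obtain ⟨y, hy1, hy⟩ := exists_dual_vector'' ℝ (φ ω - b)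
        have := h y hy1
        rw [← map_sub, hy] at this
        simpa using this
    rw [this]
    exact isClosed_iInter fun y => isClosed_iInter fun _ =>
      isClosed_le ((hcont y).sub continuous_const) continuous_const
  have hunion : ⋃ b, C b = univ := eq_univ_of_forall fun ω => by
    obtain ⟨b, hb, hωb⟩ := Metric.mem_closure_iff.1 (hc (hmem ω)) (ε / 2) (by positivity)
    exact mem_iUnion.2 ⟨⟨b, hb⟩, by rw [dist_eq_norm] at hωb; exact hωb.le⟩
  have := hcc.to_subtype
  obtain ⟨b, ω, hω⟩ := nonempty_interior_of_iUnion_of_closed hclosed hunion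
  obtain ⟨F, u, hu, hsub⟩ := isOpen_pi_iff.1 isOpen_interior ω hω
  obtain ⟨k, hk⟩ := Infinite.exists_notMem_finset F
  have hin : ∀ c : Bool, ‖φ (Function.update ω k c) - b‖ ≤ ε / 2 := fun c => by
    have : Function.update ω k c ∈ C b := interior_subset (hsub fun i hi => by
      rw [Function.update_of_ne (by rintro rfl; exact hk hi)]
      exact (hu i hi).2)
    exact this
  have hdiff : φ (Function.update ω k true) - φ (Function.update ω k false) = v k := by
    refine (SeparatingDual.eq_iff_forall_dual_eq (R := ℝ)).2 fun y => ?_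
    have hs : ∀ ω : ℕ → Bool, Summable fun k => if ω k then y (v k) else 0 := fun ω =>
      Summable.of_norm_bounded (hv y) fun k => by split_ifs <;> simp
    rw [map_sub, hφ, hφ, ← (hs _).tsum_sub (hs _), tsum_eq_single k]
    · simp
    · intro j hj
      simp [Function.update_of_ne hj]
  refine ⟨k, ?_⟩
  calc ‖v k‖ = ‖(φ (Function.update ω k true) - b) - (φ (Function.update ω k false) - b)‖ := by
        rw [← hdiff]; congr 1; abel
    _ ≤ ε := (norm_sub_le _ _).trans (by linarith [hin true, hin false])

/-! ### Henstock sums and Riemann measurability -/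

/-- `RSum δ f b s`: the vector `s` is a Riemann sum of `f` over a `δ`-fine Perron partition
of `[0,b]`. -/
inductive RSum (δ : ℝ → ℝ) (f : ℝ → X) : ℝ → X → Prop
  | nil : RSum δ f 0 0
  | snoc {b c t : ℝ} {s : X} : RSum δ f b s → b ≤ c → t ∈ Icc b c →
      Icc b c ⊆ Ioo (t - δ t) (t + δ t) → RSum δ f c (s + (c - b) • f t)

theorem RSum.exists_fin {δ : ℝ → ℝ} {f : ℝ → X} {b : ℝ} {s : X} (h : RSum δ f b s) :
    ∃ (n : ℕ) (pt : Fin (n + 1) → ℝ) (tag : Fin n → ℝ), pt 0 = 0 ∧ pt (Fin.last n) = b ∧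
      (∀ i : Fin n, pt i.castSucc ≤ pt i.succ ∧ tag i ∈ Icc (pt i.castSucc) (pt i.succ) ∧
        Icc (pt i.castSucc) (pt i.succ) ⊆ Ioo (tag i - δ (tag i)) (tag i + δ (tag i))) ∧
      ∑ i : Fin n, (pt i.succ - pt i.castSucc) • f (tag i) = s := by
  induction h with
  | nil => exact ⟨0, fun _ => 0, Fin.elim0, rfl, rfl, fun i => i.elim0, by simp⟩
  | @snoc b c t s _ hbc ht hsub ih =>
    obtain ⟨n, pt, tag, h0, hl, hi, hs⟩ := ih
    refine ⟨n + 1, Fin.snoc (α := fun _ => ℝ) pt c, Fin.snoc (α := fun _ => ℝ) tag t, ?_,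
      by simp, ?_, ?_⟩
    · rw [← h0]
      exact Fin.snoc_castSucc (α := fun _ => ℝ) c pt 0
    · rw [Fin.forall_fin_succ']
      constructor
      · intro i
        simpa only [Fin.snoc_castSucc, Fin.succ_castSucc] using hi i
      · simp only [Fin.snoc_castSucc, Fin.succ_last, Fin.snoc_last, hl]
        exact ⟨hbc, ht, hsub⟩
    · rw [Fin.sum_univ_castSucc]
      simp only [Fin.snoc_castSucc, Fin.succ_castSucc, Fin.succ_last, Fin.snoc_last, hl, hs]

theorem RSum.exists_tp {δ : ℝ → ℝ} {f : ℝ → X} {s : X} (h : RSum δ f 1 s) :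
    ∃ (n : ℕ) (P : TP n), P.IsPerron ∧ P.IsFine δ ∧ fSum P f = s := by
  obtain ⟨n, pt, tag, h0, hl, hi, hs⟩ := h.exists_fin
  have hmono : Monotone pt := Fin.monotone_iff_le_succ.2 fun i => (hi i).1
  refine ⟨n, ⟨pt, tag, hmono, h0, hl, fun i => ?_⟩, fun i => (hi i).2.1, fun i => (hi i).2.2, hs⟩
  exact ⟨h0 ▸ (hmono (Fin.zero_le _)).trans (hi i).2.1.1,
    hl ▸ (hi i).2.1.2.trans (hmono (Fin.le_last _))⟩

/-- Cousin's lemma, as the possibility of extending fine partitions. -/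
theorem exists_rsum_extension {δ : ℝ → ℝ} (hδ : IsGauge δ) (f : ℝ → X) {b c : ℝ} (hb : 0 ≤ b)
    (hbc : b ≤ c) (hc : c ≤ 1) : ∃ r, ∀ s, RSum δ f b s → RSum δ f c (s + r) := by
  let S : Set ℝ := {x | x ∈ Icc b c ∧ ∃ r, ∀ s, RSum δ f b s → RSum δ f x (s + r)}
  have hbS : b ∈ S := ⟨⟨le_rfl, hbc⟩, 0, fun s hs => by simpa using hs⟩
  have hbdd : BddAbove S := ⟨c, fun x hx => hx.1.2⟩
  have hle : sSup S ≤ c := csSup_le ⟨b, hbS⟩ fun x hx => hx.1.2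
  have hge : b ≤ sSup S := le_csSup hbdd hbS
  have hpos := hδ (sSup S) ⟨hb.trans hge, hle.trans hc⟩
  obtain ⟨x, hx, hlt⟩ := exists_lt_of_lt_csSup ⟨b, hbS⟩
    (sub_lt_self (sSup S) (half_pos hpos))
  have hxle : x ≤ sSup S := le_csSup hbdd hx
  set e := min c (sSup S + δ (sSup S) / 2) with he
  have hSe : sSup S ≤ e := le_min hle (by linarith)
  obtain ⟨hxI, r, hr⟩ := hx
  have heS : e ∈ S := by
    refine ⟨⟨hge.trans hSe, min_le_left _ _⟩, r + (e - x) • f (sSup S), fun s hs => ?_⟩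
    rw [← add_assoc]
    refine (hr s hs).snoc (hxle.trans hSe) ⟨hxle, hSe⟩ fun z hz => ⟨by linarith [hz.1], ?_⟩
    have := hz.2.trans (min_le_right _ _)
    linarith
  have hec : e = c := by
    have h1 := le_csSup hbdd heS
    rcases min_choice c (sSup S + δ (sSup S) / 2) with h | h
    · exact h
    · rw [he, h] at h1
      linarith
  exact hec ▸ heS.2

/-- The `k`-th cell of the subdivision of `[0,1)` into `q` intervals of equal length. -/
def cell (q k : ℕ) : Set ℝ := Ico ((k : ℝ) / q) ((k + 1 : ℝ) / q)

theorem norm_sum_cells_lt {δ : ℝ → ℝ} (hδ : IsGauge δ) {f : ℝ → X} {w : X} {ε : ℝ}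
    (h : ∀ (n : ℕ) (P : TP n), P.IsPerron → P.IsFine δ → ‖w - fSum P f‖ < ε) {q : ℕ}
    (hq : 0 < q) {t t' : ℕ → ℝ}
    (ht : ∀ k < q, t k = t' k ∨ (t k ∈ cell q k ∧ t' k ∈ cell q k ∧
      1 / (q : ℝ) < δ (t k) ∧ 1 / (q : ℝ) < δ (t' k))) :
    ‖∑ k ∈ Finset.range q, (1 / (q : ℝ)) • (f (t k) - f (t' k))‖ < 2 * ε := by
  have hq0 : (0 : ℝ) < q := by exact_mod_cast hq
  have key : ∀ m ≤ q, ∃ s s', RSum δ f ((m : ℝ) / q) s ∧ RSum δ f ((m : ℝ) / q) s' ∧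
      s - s' = ∑ k ∈ Finset.range m, (1 / (q : ℝ)) • (f (t k) - f (t' k)) := by
    intro m
    induction m with
    | zero => exact fun _ => ⟨0, 0, by simpa using RSum.nil, by simpa using RSum.nil, by simp⟩
    | succ m ih =>
      intro hm
      obtain ⟨s, s', hs, hs', hss⟩ := ih (by omega)
      have hlen : ((m + 1 : ℕ) : ℝ) / q - (m : ℝ) / q = 1 / q := by push_cast; ring
      have hmm : (m : ℝ) / q ≤ ((m + 1 : ℕ) : ℝ) / q := by
        have : 0 < 1 / (q : ℝ) := by positivity
        linarith
      rcases ht m (by omega) with heq | ⟨h1, h2, h3, h4⟩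
      · obtain ⟨r, hr⟩ := exists_rsum_extension hδ f (b := (m : ℝ) / q)
          (c := ((m + 1 : ℕ) : ℝ) / q) (by positivity) hmm
          ((div_le_one hq0).2 (by exact_mod_cast hm))
        refine ⟨_, _, hr s hs, hr s' hs', ?_⟩
        rw [Finset.sum_range_succ, ← hss, heq]
        simp
      · have hcell : ∀ u ∈ cell q m, 1 / (q : ℝ) < δ u →
            u ∈ Icc ((m : ℝ) / q) (((m + 1 : ℕ) : ℝ) / q) ∧
            Icc ((m : ℝ) / q) (((m + 1 : ℕ) : ℝ) / q) ⊆ Ioo (u - δ u) (u + δ u) := by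
          intro u hu hδu
          have hu2 : u < ((m + 1 : ℕ) : ℝ) / q := by push_cast; exact hu.2
          have hu1 : (m : ℝ) / q ≤ u := hu.1
          exact ⟨⟨hu1, hu2.le⟩, fun z hz => ⟨by linarith [hz.1], by linarith [hz.2]⟩⟩
        refine ⟨_, _, hs.snoc hmm (hcell _ h1 h3).1 (hcell _ h1 h3).2,
          hs'.snoc hmm (hcell _ h2 h4).1 (hcell _ h2 h4).2, ?_⟩
        rw [Finset.sum_range_succ, ← hss, hlen, smul_sub]
        abel
  obtain ⟨s, s', hs, hs', hss⟩ := key q le_rfl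
  rw [div_self hq0.ne'] at hs hs'
  obtain ⟨n, P, hP, hPδ, rfl⟩ := hs.exists_tp
  obtain ⟨n', P', hP', hPδ', rfl⟩ := hs'.exists_tp
  rw [← hss]
  calc ‖fSum P f - fSum P' f‖ = ‖(w - fSum P' f) - (w - fSum P f)‖ := by congr 1; abel
    _ ≤ ‖w - fSum P' f‖ + ‖w - fSum P f‖ := norm_sub_le _ _
    _ < 2 * ε := by linarith [h n P hP hPδ, h n' P' hP' hPδ']

theorem exists_measurable_gauge_bound {δ : ℝ → ℝ} (hδ : IsGauge δ) (hm : AEMeasurable δ volume)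
    {ρ : ℝ≥0∞} (hρ : 0 < ρ) : ∃ q : ℕ, 0 < q ∧ ∃ A ⊆ Ico (0:ℝ) 1, MeasurableSet A ∧
      volume (Icc (0:ℝ) 1 \ A) ≤ ρ ∧ ∀ t ∈ A, 1 / (q : ℝ) < δ t := by
  obtain ⟨δ', hδ'm, hδδ'⟩ := hm
  set N := toMeasurable volume {t | δ t ≠ δ' t} with hN
  have hN0 : volume N = 0 := by rw [hN, measure_toMeasurable]; exact hδδ'
  have hNm : MeasurableSet N := measurableSet_toMeasurable _ _
  have hout : ∀ t ∉ N, δ t = δ' t := fun t ht => by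
    by_contra hne
    exact ht (subset_toMeasurable _ _ hne)
  let A : ℕ → Set ℝ := fun q => (Ico 0 1 ∩ {t | 1 / ((q : ℝ) + 1) < δ' t}) \ N
  have hAm : ∀ q, MeasurableSet (A q) := fun q =>
    (measurableSet_Ico.inter (measurableSet_lt measurable_const hδ'm)).diff hNm
  have hmono : Antitone fun q => Icc (0:ℝ) 1 \ A q := by
    refine fun q q' hqq' => sdiff_subset_sdiff_right fun t ht => ⟨⟨ht.1.1, ?_⟩, ht.2⟩
    have : (q : ℝ) ≤ q' := by exact_mod_cast hqq'
    have h : 1 / ((q' : ℝ) + 1) ≤ 1 / ((q : ℝ) + 1) :=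
      one_div_le_one_div_of_le (by positivity) (by linarith)
    exact h.trans_lt ht.1.2
  have hlim := tendsto_measure_iInter_atTop (μ := volume) (s := fun q => Icc (0:ℝ) 1 \ A q)
    (fun q => (measurableSet_Icc.diff (hAm q)).nullMeasurableSet) hmono
    ⟨0, ((measure_mono sdiff_subset).trans_lt (by simp)).ne⟩
  have hzero : volume (⋂ q, Icc (0:ℝ) 1 \ A q) = 0 := by
    refine measure_mono_null (t := {1} ∪ N) (fun t ht => ?_)
      (measure_union_null (by simp) hN0)
    by_contra hcon
    simp only [mem_union, mem_singleton_iff, not_or] at hcon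
    have htI := (mem_iInter.1 ht 0).1
    have hpos := hδ t htI
    rw [hout t hcon.2] at hpos
    obtain ⟨q, hq⟩ := exists_nat_one_div_lt hpos
    exact (mem_iInter.1 ht q).2 ⟨⟨⟨htI.1, lt_of_le_of_ne htI.2 hcon.1⟩, hq⟩, hcon.2⟩
  rw [hzero] at hlim
  obtain ⟨q, hq⟩ := (hlim.eventually (ge_mem_nhds hρ)).exists
  refine ⟨q + 1, q.succ_pos, A q, fun t ht => ht.1.1, hAm q, hq, fun t ht => ?_⟩
  rw [hout t ht.2]
  push_cast
  exact ht.1.2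

/-- Riemann measurability of `ℋ`-integrable functions. -/
theorem FHMeasIntegrable.exists_cells {f : ℝ → X} (hf : FHMeasIntegrable f) {ε : ℝ} (hε : 0 < ε)
    {ρ : ℝ≥0∞} (hρ : 0 < ρ) : ∃ q : ℕ, 0 < q ∧ ∃ A ⊆ Ico (0:ℝ) 1, MeasurableSet A ∧
      volume (Icc (0:ℝ) 1 \ A) ≤ ρ ∧ (∀ k < q, ∃ M, ∀ t ∈ A ∩ cell q k, ‖f t‖ ≤ M) ∧
      ∀ y : X →L[ℝ] ℝ, ‖y‖ ≤ 1 → ∑ k ∈ Finset.range q,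
        ENNReal.ofReal (1 / q) * ediam ((fun t => y (f t)) '' (A ∩ cell q k)) ≤
          ENNReal.ofReal ε := by
  obtain ⟨w, hw⟩ := hf
  obtain ⟨δ, hδ, hδm, hfine⟩ := hw (ε / 2) (by positivity)
  obtain ⟨q, hq, A, hA, hAm, hAρ, hAδ⟩ := exists_measurable_gauge_bound hδ hδm hρ
  have hq0 : (0 : ℝ) < q := by exact_mod_cast hq
  have hosc : ∀ k < q, ∀ t ∈ A ∩ cell q k, ∀ t' ∈ A ∩ cell q k, ‖f t - f t'‖ ≤ ε * q := by
    intro k hk t ht t' ht'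
    have := norm_sum_cells_lt hδ hfine hq (t := Function.update (fun _ => 0) k t)
      (t' := Function.update (fun _ => 0) k t') fun j _ => by
        rcases eq_or_ne j k with rfl | hj
        · simpa using Or.inr ⟨ht.2, ht'.2, by simpa using hAδ t ht.1, by simpa using hAδ t' ht'.1⟩
        · left; simp [hj]
    rw [Finset.sum_eq_single k (fun j _ hj => by simp [hj]) (fun h => absurd hk (by simpa using h)),
      norm_smul, Real.norm_of_nonneg (by positivity)] at this
    simp only [Function.update_self] at this
    rw [one_div, inv_mul_lt_iff₀ hq0] at this
    linarith
  refine ⟨q, hq, A, hA, hAm, hAρ, fun k hk => ?_, fun y hy => ?_⟩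
  · rcases (A ∩ cell q k).eq_empty_or_nonempty with he | ⟨t, ht⟩
    · exact ⟨0, by simp [he]⟩
    · refine ⟨‖f t‖ + ε * q, fun t' ht' => ?_⟩
      have h1 := hosc k hk t' ht' t ht
      have h2 := norm_sub_norm_le (f t') (f t)
      linarith
  · set D : ℕ → ℝ≥0∞ := fun k => ediam ((fun t => y (f t)) '' (A ∩ cell q k)) with hD
    have hDfin : ∀ k < q, D k ≠ ⊤ := fun k hk => by
      refine ne_top_of_le_ne_top ENNReal.ofReal_ne_top (b := ENNReal.ofReal (ε * q)) ?_
      refine ediam_le ?_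
      rintro _ ⟨t, ht, rfl⟩ _ ⟨t', ht', rfl⟩
      rw [edist_dist, dist_eq_norm, ← map_sub]
      refine ENNReal.ofReal_le_ofReal ((y.le_of_opNorm_le hy _).trans ?_)
      rw [one_mul]
      exact hosc k hk t ht t' ht'
    refine ENNReal.le_of_forall_pos_le_add fun η hη _ => ?_
    have hch : ∀ k, ∃ t t', k < q → (t = t' ∨ (t ∈ A ∩ cell q k ∧ t' ∈ A ∩ cell q k)) ∧
        0 ≤ y (f t - f t') ∧ D k ≤ ENNReal.ofReal (y (f t - f t')) + η := by
      intro k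
      by_cases hk : k < q
      swap
      · exact ⟨0, 0, fun h => absurd h hk⟩
      by_cases hDη : D k ≤ η
      · exact ⟨0, 0, fun _ => ⟨Or.inl rfl, by simp, by simpa using hDη⟩⟩
      have hlt : D k - η < D k := ENNReal.sub_lt_self (hDfin k hk)
        (fun h => hDη (by simp [h])) (by simpa using hη.ne')
      have hnot := mt ediam_le_iff.2 hlt.not_ge
      push Not at hnot
      obtain ⟨_, ⟨t, ht, rfl⟩, _, ⟨t', ht', rfl⟩, hlt'⟩ := hnot
      have hle := tsub_le_iff_right.1 hlt'.le
      rw [edist_dist, Real.dist_eq, ← map_sub] at hle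
      rcases le_total 0 (y (f t - f t')) with h0 | h0
      · refine ⟨t, t', fun _ => ⟨Or.inr ⟨ht, ht'⟩, h0, ?_⟩⟩
        rwa [abs_of_nonneg h0] at hle
      · refine ⟨t', t, fun _ => ⟨Or.inr ⟨ht', ht⟩, ?_, ?_⟩⟩
        · rw [map_sub] at h0 ⊢; linarith
        · rwa [abs_of_nonpos h0, map_sub, neg_sub, ← map_sub] at hle
    choose t t' htt using hch
    have hlt := norm_sum_cells_lt hδ hfine hq (t := t) (t' := t') fun k hk =>
      (htt k hk).1.imp_right fun h => ⟨h.1.2, h.2.2, hAδ _ h.1.1, hAδ _ h.2.1⟩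
    have hsum : ∑ k ∈ Finset.range q, 1 / (q : ℝ) * y (f (t k) - f (t' k)) ≤ ε := by
      have := (le_abs_self _).trans (y.le_of_opNorm_le hy
        (∑ k ∈ Finset.range q, (1 / (q : ℝ)) • (f (t k) - f (t' k))))
      simp only [map_sum, map_smul, smul_eq_mul] at this
      linarith
    calc ∑ k ∈ Finset.range q, ENNReal.ofReal (1 / q) * D k
        ≤ ∑ k ∈ Finset.range q, (ENNReal.ofReal (1 / (q : ℝ) * y (f (t k) - f (t' k))) +
            ENNReal.ofReal (1 / q) * η) := Finset.sum_le_sum fun k hk => by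
          rw [ENNReal.ofReal_mul (by positivity), ← mul_add]
          gcongr
          exact (htt k (Finset.mem_range.1 hk)).2.2
      _ = ENNReal.ofReal (∑ k ∈ Finset.range q, 1 / (q : ℝ) * y (f (t k) - f (t' k))) + η := by
          rw [Finset.sum_add_distrib, ENNReal.ofReal_sum_of_nonneg]
          · congr 1
            rw [Finset.sum_const, Finset.card_range, nsmul_eq_mul, ← mul_assoc,
              ← ENNReal.ofReal_natCast, ← ENNReal.ofReal_mul (by positivity),
              mul_one_div_cancel hq0.ne', ENNReal.ofReal_one, one_mul]
          · exact fun k hk => mul_nonneg (by positivity) (htt k (Finset.mem_range.1 hk)).2.1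
      _ ≤ ENNReal.ofReal ε + η := by gcongr

/-! ### Countable partitions with small weak oscillation -/

/-- The diameter of the image under `y ∘ f` of the piece of index `j` of the partition of
`[0,1]` determined by `idx`. -/
noncomputable def oscOn (f : ℝ → X) (idx : ℝ → ℕ × ℕ) (y : X →L[ℝ] ℝ) (j : ℕ × ℕ) : ℝ≥0∞ :=
  ediam ((fun t => y (f t)) '' (Icc (0:ℝ) 1 ∩ idx ⁻¹' {j}))

theorem mem_cell_floor {q : ℕ} (hq : 0 < q) {t : ℝ} (ht : 0 ≤ t) :
    t ∈ cell q ⌊q * t⌋₊ := by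
  have hq0 : (0 : ℝ) < q := by exact_mod_cast hq
  refine ⟨?_, ?_⟩
  · rw [div_le_iff₀ hq0, mul_comm t]
    exact Nat.floor_le (by positivity)
  · rw [lt_div_iff₀ hq0, mul_comm t]
    exact Nat.lt_floor_add_one _

theorem measurableSet_cell (q k : ℕ) : MeasurableSet (cell q k) := measurableSet_Ico

theorem volume_cell {q : ℕ} (k : ℕ) : volume (cell q k) = ENNReal.ofReal (1 / q) := by
  rw [cell, Real.volume_Ico]
  congr 1
  ring

open Classical in
theorem FHMeasIntegrable.exists_index {f : ℝ → X} (hf : FHMeasIntegrable f) {ε : ℝ}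
    (hε : 0 < ε) : ∃ idx : ℝ → ℕ × ℕ, AEMeasurable idx volume ∧
      (∀ j, ∃ M, ∀ t ∈ Icc (0:ℝ) 1, idx t = j → ‖f t‖ ≤ M) ∧
      ∀ y : X →L[ℝ] ℝ, ‖y‖ ≤ 1 →
        ∫⁻ s in Icc (0:ℝ) 1, oscOn f idx y (idx s) ≤ ENNReal.ofReal ε := by
  have h := fun n : ℕ => hf.exists_cells (ε := ε / 2 / 2 ^ n) (by positivity)
    (ρ := ((n : ℝ≥0∞) + 1)⁻¹) (by simp)
  choose q hq A hA hAm hAρ hM hosc using h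
  set G := ⋃ n, A n with hG
  have hGm : MeasurableSet G := MeasurableSet.iUnion hAm
  have hGI : G ⊆ Icc (0:ℝ) 1 := iUnion_subset fun n => (hA n).trans Ico_subset_Icc_self
  have hG0 : volume (Icc (0:ℝ) 1 \ G) = 0 := by
    have hlim : Filter.Tendsto (fun n : ℕ => ((n : ℝ≥0∞) + 1)⁻¹) Filter.atTop (nhds 0) := by
      have := (Filter.tendsto_add_atTop_iff_nat 1).2 ENNReal.tendsto_inv_nat_nhds_zero
      simpa using this
    refine le_antisymm (ge_of_tendsto' hlim fun n => ?_) zero_le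
    exact (measure_mono (sdiff_subset_sdiff_right (subset_iUnion A n))).trans (hAρ n)
  have hex : ∀ t, ∃ n, t ∈ A n ∨ t ∉ G := fun t => by
    by_cases ht : t ∈ G
    · obtain ⟨n, hn⟩ := mem_iUnion.1 ht
      exact ⟨n, Or.inl hn⟩
    · exact ⟨0, Or.inr ht⟩
  let N : ℝ → ℕ := fun t => Nat.find (hex t)
  have hNm : Measurable N := measurable_find hex fun n => (hAm n).union hGm.compl
  let idx₀ : ℝ → ℕ × ℕ := fun t => (N t + 1, ⌊(q (N t) : ℝ) * t⌋₊)
  have hidx₀ : Measurable idx₀ := by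
    refine Measurable.prodMk ((measurable_from_nat (f := fun n => n + 1)).comp hNm)
      (Nat.measurable_floor.comp ?_)
    exact ((measurable_from_nat (f := fun n => (q n : ℝ))).comp hNm).mul measurable_id
  let idx : ℝ → ℕ × ℕ := fun t => if t ∈ G then idx₀ t else
    if t ∈ Icc (0:ℝ) 1 then (0, ⌊‖f t‖⌋₊) else (0, 0)
  have hpiece : ∀ t n k, idx t = (n + 1, k) → t ∈ A n ∩ cell (q n) k := by
    intro t n k ht
    have htG : t ∈ G := by
      by_contra hcon
      simp only [idx, if_neg hcon] at ht
      split_ifs at ht <;> simp at ht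
    simp only [idx, if_pos htG, idx₀, Prod.mk.injEq, add_left_inj] at ht
    obtain ⟨hn, hk⟩ := ht
    have hspec := (Nat.find_spec (hex t)).resolve_right (not_not.2 htG)
    change t ∈ A (N t) at hspec
    rw [hn] at hspec hk
    exact ⟨hspec, hk ▸ mem_cell_floor (hq n) (hA n hspec).1⟩
  have hk_lt : ∀ t n k, t ∈ A n ∩ cell (q n) k → k < q n := by
    intro t n k ht
    have h1 := (hA n ht.1).2
    have h2 := ht.2.1
    have hq0 : (0 : ℝ) < q n := by exact_mod_cast hq n
    have h3 : (k : ℝ) / q n < 1 := h2.trans_lt h1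
    rw [div_lt_one hq0] at h3
    exact_mod_cast h3
  refine ⟨idx, ?_, ?_, ?_⟩
  · refine ⟨fun t => if t ∈ G then idx₀ t else (0, 0),
      Measurable.ite hGm hidx₀ measurable_const, ?_⟩
    refine measure_mono_null (fun t ht => ?_) hG0
    by_contra hcon
    apply ht
    by_cases htG : t ∈ G
    · simp [idx, htG]
    · have : t ∉ Icc (0:ℝ) 1 := fun h => hcon ⟨h, htG⟩
      simp only [mem_ofPred_eq, idx, if_neg htG, if_neg this]
  · rintro ⟨n, k⟩
    rcases n with _ | n
    · refine ⟨k + 1, fun t ht hidx => ?_⟩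
      have htG : t ∉ G := fun hcon => by
        simp [idx, if_pos hcon, idx₀] at hidx
      simp only [idx, if_neg htG, if_pos ht, Prod.mk.injEq, true_and] at hidx
      rw [← hidx]
      exact (Nat.lt_floor_add_one _).le
    · by_cases hk : k < q n
      · obtain ⟨M, hM⟩ := hM n k hk
        exact ⟨M, fun t _ hidx => hM t (hpiece t n k hidx)⟩
      · exact ⟨0, fun t _ hidx => absurd (hk_lt t n k (hpiece t n k hidx)) hk⟩
  · intro y hy
    let D : ℕ → ℕ → ℝ≥0∞ := fun n k => ediam ((fun t => y (f t)) '' (A n ∩ cell (q n) k))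
    have hbound : ∀ s ∈ G, oscOn f idx y (idx s) ≤
        ∑' n, ∑ k ∈ Finset.range (q n), (cell (q n) k).indicator (fun _ => D n k) s := by
      intro s hs
      have hidx : idx s = (N s + 1, ⌊(q (N s) : ℝ) * s⌋₊) := if_pos hs
      have hp := hpiece _ _ _ hidx
      refine le_trans ?_ (ENNReal.le_tsum (N s))
      refine le_trans ?_ (Finset.single_le_sum (fun _ _ => zero_le)
        (Finset.mem_range.2 (hk_lt _ _ _ hp)))
      rw [indicator_of_mem hp.2, hidx]
      exact ediam_mono (image_mono fun t ht => hpiece _ _ _ ht.2)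
    have hIG : Icc (0:ℝ) 1 =ᵐ[volume] G := by
      refine Filter.EventuallyLE.antisymm ?_ (Filter.Eventually.of_forall hGI)
      exact ae_le_set.2 hG0
    calc ∫⁻ s in Icc (0:ℝ) 1, oscOn f idx y (idx s)
        = ∫⁻ s in G, oscOn f idx y (idx s) := by rw [Measure.restrict_congr_set hIG]
      _ ≤ ∫⁻ s in G, ∑' n, ∑ k ∈ Finset.range (q n),
            (cell (q n) k).indicator (fun _ => D n k) s := setLIntegral_mono' hGm hbound
      _ ≤ ∫⁻ s, ∑' n, ∑ k ∈ Finset.range (q n),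
            (cell (q n) k).indicator (fun _ => D n k) s := setLIntegral_le_lintegral _ _
      _ = ∑' n, ∑ k ∈ Finset.range (q n), ENNReal.ofReal (1 / q n) * D n k := by
          rw [lintegral_tsum]
          · refine tsum_congr fun n => ?_
            rw [lintegral_finsetSum]
            · refine Finset.sum_congr rfl fun k _ => ?_
              rw [lintegral_indicator_const (measurableSet_cell _ _), volume_cell, mul_comm]
            · exact fun k _ => measurable_const.indicator (measurableSet_cell _ _)
          · exact fun n => (Finset.measurable_fun_sum _ fun k _ =>
              measurable_const.indicator (measurableSet_cell _ _)).aemeasurable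
      _ ≤ ∑' n : ℕ, ENNReal.ofReal (ε / 2 / 2 ^ n) := ENNReal.tsum_le_tsum fun n => hosc n y hy
      _ = ENNReal.ofReal ε := by
          rw [← ENNReal.ofReal_tsum_of_nonneg (fun n => by positivity)
            (hasSum_geometric_two' ε).summable, (hasSum_geometric_two' ε).tsum_eq]

/-! ### Pettis integrability of selections -/

theorem edist_le_oscOn {f : ℝ → X} {idx : ℝ → ℕ × ℕ} {y : X →L[ℝ] ℝ} {s t : ℝ}
    (hs : s ∈ Icc (0:ℝ) 1) (ht : t ∈ Icc (0:ℝ) 1) (hst : idx s = idx t) :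
    edist (y (f s)) (y (f t)) ≤ oscOn f idx y (idx t) :=
  edist_le_ediam_of_mem (mem_image_of_mem _ ⟨hs, hst⟩) (mem_image_of_mem _ ⟨ht, rfl⟩)

theorem FHMeasIntegrable.aemeasurable_of_norm_le_one {f : ℝ → X} (hf : FHMeasIntegrable f)
    {y : X →L[ℝ] ℝ} (hy : ‖y‖ ≤ 1) :
    AEMeasurable (fun t => y (f t)) (volume.restrict (Icc (0:ℝ) 1)) := by
  have h := fun p : ℕ => hf.exists_index (ε := 1 / ((p : ℝ) + 1)) (by positivity)
  choose idx hidx _ hosc using h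
  have hc : ∀ p j, ∃ c : ℝ, ∀ s ∈ Icc (0:ℝ) 1, idx p s = j →
      edist c (y (f s)) ≤ oscOn f (idx p) y j := fun p j => by
    by_cases hj : ∃ s ∈ Icc (0:ℝ) 1, idx p s = j
    · obtain ⟨s, hs, rfl⟩ := hj
      exact ⟨y (f s), fun t ht hst => hst ▸ edist_le_oscOn hs ht hst.symm⟩
    · exact ⟨0, fun s hs hsj => absurd ⟨s, hs, hsj⟩ hj⟩
  choose c hc using hc
  have hidx' : ∀ p, AEMeasurable (idx p) (volume.restrict (Icc (0:ℝ) 1)) :=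
    fun p => (hidx p).restrict
  refine TendstoInMeasure.aemeasurable (u := Filter.atTop) (f := fun p t => c p (idx p t))
    (fun p => (measurable_of_countable (c p)).comp_aemeasurable (hidx' p)) ?_
  intro ε hε
  rcases eq_or_ne ε ⊤ with rfl | hεt
  · simp [edist_ne_top]
  have hlim : Filter.Tendsto (fun p : ℕ => ENNReal.ofReal (1 / ((p : ℝ) + 1)) / ε) Filter.atTop
      (nhds 0) := by
    have h1 := ENNReal.tendsto_ofReal (tendsto_one_div_add_atTop_nhds_zero_nat (𝕜 := ℝ))
    have h2 := ENNReal.Tendsto.div_const h1 (Or.inr hε.ne')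
    simpa using h2
  refine tendsto_of_tendsto_of_tendsto_of_le_of_le tendsto_const_nhds hlim
    (fun _ => zero_le) fun p => ?_
  rw [ENNReal.le_div_iff_mul_le (Or.inl hε.ne') (Or.inl hεt), mul_comm]
  refine le_trans ?_ (hosc p y hy)
  refine le_trans ?_ (mul_meas_ge_le_lintegral₀
    ((measurable_of_countable (oscOn f (idx p) y)).comp_aemeasurable (hidx' p)) ε)
  gcongr ε * ?_
  rw [Measure.restrict_apply' measurableSet_Icc, Measure.restrict_apply' measurableSet_Icc]
  exact measure_mono fun t ht => ⟨le_trans ht.1 (hc p _ t ht.2 rfl), ht.2⟩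

theorem FHMeasIntegrable.aemeasurable {f : ℝ → X} (hf : FHMeasIntegrable f) (y : X →L[ℝ] ℝ) :
    AEMeasurable (fun t => y (f t)) (volume.restrict (Icc (0:ℝ) 1)) := by
  have hpos : 0 < ‖y‖ + 1 := by positivity
  have h := hf.aemeasurable_of_norm_le_one (y := (‖y‖ + 1)⁻¹ • y) (by
    rw [norm_smul, Real.norm_of_nonneg (by positivity), inv_mul_le_iff₀ hpos]
    linarith)
  refine (h.const_mul (‖y‖ + 1)).congr (Filter.Eventually.of_forall fun t => ?_)
  simp [hpos.ne']

theorem FHMeasIntegrable.integrableOn_of_selection {Γ : ℝ → Set X} {f : ℝ → X}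
    (hΓ : ∀ t ∈ Icc (0:ℝ) 1, IsCWK X (Γ t)) (hP : PettisIntegrable Γ) (hs : Selection Γ f)
    (hf : FHMeasIntegrable f) (y : X →L[ℝ] ℝ) :
    IntegrableOn (fun t => y (f t)) (Icc (0:ℝ) 1) volume := by
  refine Integrable.mono' ((hP.1 y).abs.add (hP.1 (-y)).abs)
    (hf.aemeasurable y).aestronglyMeasurable ?_
  refine (ae_restrict_iff' measurableSet_Icc).2 (Filter.Eventually.of_forall fun t ht => ?_)
  have h1 := le_suppFn (hΓ t ht).2.2 y (hs t ht)
  have h2 := le_suppFn (hΓ t ht).2.2 (-y) (hs t ht)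
  simp only [neg_apply] at h2
  simp only [Pi.add_apply, Real.norm_eq_abs]
  rw [abs_le]
  constructor
  · linarith [le_abs_self (suppFn (-y) (Γ t)), abs_nonneg (suppFn y (Γ t))]
  · linarith [le_abs_self (suppFn y (Γ t)), abs_nonneg (suppFn (-y) (Γ t))]

theorem FHMeasIntegrable.fPettisIntegrable_of_selection {Γ : ℝ → Set X} {f : ℝ → X}
    (hΓ : ∀ t ∈ Icc (0:ℝ) 1, IsCWK X (Γ t)) (hP : PettisIntegrable Γ) (hs : Selection Γ f)
    (hf : FHMeasIntegrable f) : FPettisIntegrable f := by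
  have hint := hf.integrableOn_of_selection hΓ hP hs
  refine ⟨hint, fun E hE hEm => ?_⟩
  obtain ⟨W, hW, hWs⟩ := hP.2 E hE hEm
  let L : (X →L[ℝ] ℝ) →ₗ[ℝ] ℝ :=
    { toFun := fun y => ∫ t in E, y (f t)
      map_add' := fun y z => integral_add ((hint y).mono_set hE) ((hint z).mono_set hE)
      map_smul' := fun c y => integral_const_mul c _ }
  obtain ⟨ν, -, hν⟩ := exists_eq_eval_of_le_suppFn hW L fun y => by
    rw [hWs]
    refine setIntegral_mono_on₀ ((hint y).mono_set hE) ((hP.1 y).mono_set hE) hEm fun t ht => ?_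
    exact le_suppFn (hΓ t (hE ht)).2.2 y (hs t (hE ht))
  exact ⟨ν, hν⟩

/-! ### Uniform integrability -/

/-- The Pettis integrals of a Pettis integrable function over small sets are small. -/
theorem FPettisIntegrable.exists_abs_setIntegral_le {f : ℝ → X} (hf : FPettisIntegrable f) {ε : ℝ}
    (hε : 0 < ε) : ∃ η : ℝ≥0∞, 0 < η ∧ ∀ B ⊆ Icc (0:ℝ) 1, MeasurableSet B → volume B ≤ η →
      ∀ y : X →L[ℝ] ℝ, ‖y‖ ≤ 1 → |∫ t in B, y (f t)| ≤ ε := by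
  by_contra! hcon
  have hchoice := fun n : ℕ => hcon ((1 / 2) ^ n) (ENNReal.pow_pos (by simp) n)
  choose E hEI hEm hEv y hy hyE using hchoice
  let T : ℕ → Set ℝ := fun m => ⋃ j, E (m + j)
  have hTI : ∀ m, T m ⊆ Icc (0:ℝ) 1 := fun m => iUnion_subset fun j => hEI _
  have hTm : ∀ m, MeasurableSet (T m) := fun m => MeasurableSet.iUnion fun j => hEm _
  have hTanti : ∀ m m', m ≤ m' → T m' ⊆ T m := fun m m' h => iUnion_subset fun j => by
    obtain ⟨d, rfl⟩ := Nat.exists_eq_add_of_le h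
    rw [add_assoc]
    exact subset_iUnion (fun j => E (m + j)) (d + j)
  have hET : ∀ m, E m ⊆ T m := fun m => subset_iUnion (fun j => E (m + j)) 0
  have hTv : Filter.Tendsto (fun m => volume (T m)) Filter.atTop (nhds 0) := by
    have h : ∀ m, volume (T m) ≤ (1 / 2) ^ m * 2 := fun m => by
      calc volume (T m) ≤ ∑' j, volume (E (m + j)) := measure_iUnion_le _
        _ ≤ ∑' j, (1 / 2 : ℝ≥0∞) ^ (m + j) := ENNReal.tsum_le_tsum fun j => hEv _
        _ = (1 / 2) ^ m * 2 := by
          simp_rw [pow_add]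
          rw [ENNReal.tsum_mul_left, one_div, ENNReal.tsum_geometric, ENNReal.one_sub_inv_two, inv_inv]
    refine tendsto_of_tendsto_of_tendsto_of_le_of_le tendsto_const_nhds ?_ (fun _ => zero_le) h
    have := ENNReal.Tendsto.mul_const (b := 2)
      (ENNReal.tendsto_pow_atTop_nhds_zero_of_lt_one (r := 1 / 2) (by simp)) (Or.inr (by simp))
    simpa using this
  have hstep : ∀ n, ∃ m > n, ∀ F ⊆ T m, MeasurableSet F → |∫ t in F, y n (f t)| < ε / 2 := by
    intro n
    have hlim := tendsto_setLIntegral_zero (μ := volume.restrict (Icc (0:ℝ) 1))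
      (f := fun t => ‖y n (f t)‖ₑ) (s := T) (l := Filter.atTop)
      (hf.1 (y n)).hasFiniteIntegral.ne (hTv.congr fun m => by
        rw [Function.comp_apply, Measure.restrict_apply' measurableSet_Icc,
          inter_eq_self_of_subset_left (hTI _)])
    obtain ⟨m, hm, hmn⟩ := ((hlim.eventually (gt_mem_nhds (ENNReal.ofReal_pos.2
      (half_pos hε)))).and (Filter.eventually_gt_atTop n)).exists
    refine ⟨m, hmn, fun F hF hFm => ?_⟩
    have h1 : ENNReal.ofReal |∫ t in F, y n (f t)| < ENNReal.ofReal (ε / 2) := by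
      rw [← Real.norm_eq_abs, ofReal_norm]
      refine (enorm_integral_le_lintegral_enorm _).trans_lt (lt_of_le_of_lt ?_ hm)
      rw [Measure.restrict_restrict (hTm m), inter_eq_self_of_subset_left (hTI m)]
      exact lintegral_mono_set hF
    exact (ENNReal.ofReal_lt_ofReal_iff (half_pos hε)).1 h1
  choose next hnext hsmall using hstep
  let n : ℕ → ℕ := fun k => next^[k] 0
  have hn : ∀ k, n (k + 1) = next (n k) := fun k => Function.iterate_succ_apply' next k 0
  have hnmono : StrictMono n := strictMono_nat_of_lt_succ fun k => by rw [hn]; exact hnext _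
  let F : ℕ → Set ℝ := fun k => E (n k) \ T (n (k + 1))
  have hFm : ∀ k, MeasurableSet (F k) := fun k => (hEm _).diff (hTm _)
  have hFI : ∀ k, F k ⊆ Icc (0:ℝ) 1 := fun k => sdiff_subset.trans (hEI _)
  have hFd : Pairwise (Function.onFun Disjoint F) := by
    refine (pairwise_disjoint_on F).2 fun i j hij => ?_
    refine disjoint_left.2 fun t hi hj => hi.2 ?_
    exact hTanti _ _ (hnmono.monotone hij) (hET _ hj.1)
  have hFint : ∀ k, ε / 2 < |∫ t in F k, y (n k) (f t)| := fun k => by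
    have h1 := hyE (n k)
    have h2 := hsmall (n k) (E (n k) ∩ T (n (k + 1))) (by rw [hn]; exact inter_subset_right)
      ((hEm _).inter (hTm _))
    rw [← integral_inter_add_sdiff (hTm (n (k + 1))) ((hf.1 (y (n k))).mono_set (hEI _))] at h1
    have h3 := abs_add_le (∫ t in E (n k) ∩ T (n (k + 1)), y (n k) (f t))
      (∫ t in F k, y (n k) (f t))
    linarith
  have hν : ∀ G : Set ℝ, ∃ z : X, G ⊆ Icc (0:ℝ) 1 → MeasurableSet G →
      ∀ x' : X →L[ℝ] ℝ, x' z = ∫ t in G, x' (f t) := fun G => by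
    by_cases hG : G ⊆ Icc (0:ℝ) 1 ∧ MeasurableSet G
    · obtain ⟨z, hz⟩ := hf.2 G hG.1 hG.2.nullMeasurableSet
      exact ⟨z, fun _ _ => hz⟩
    · exact ⟨0, fun h1 h2 => absurd ⟨h1, h2⟩ hG⟩
  choose ν hν using hν
  have hsub : ∀ (x' : X →L[ℝ] ℝ) (ω : ℕ → Bool), HasSum
      (fun k => ∫ t in (if ω k then F k else ∅), x' (f t))
      (∫ t in ⋃ k, (if ω k then F k else ∅), x' (f t)) := fun x' ω => by
    refine hasSum_integral_iUnion (fun k => ?_) (fun i j hij => ?_) ?_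
    · split_ifs
      exacts [hFm k, MeasurableSet.empty]
    · have := hFd hij
      simp only [Function.onFun] at this ⊢
      split_ifs <;> simp [this]
    · refine (hf.1 x').mono_set (iUnion_subset fun k => ?_)
      split_ifs
      exacts [hFI k, empty_subset _]
  obtain ⟨k, hk⟩ := exists_norm_le_of_weak_subseries (v := fun k => ν (F k))
    (φ := fun ω => ν (⋃ k, if ω k then F k else ∅)) (fun x' => by
      have := (hsub x' fun _ => true).summable.abs
      simpa [hν (F _) (hFI _) (hFm _)] using this) (fun x' ω => by
      have hU : (⋃ k, if ω k then F k else ∅) ⊆ Icc (0:ℝ) 1 := iUnion_subset fun k => by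
        split_ifs
        exacts [hFI k, empty_subset _]
      have hUm : MeasurableSet (⋃ k, if ω k then F k else ∅) := MeasurableSet.iUnion fun k => by
        split_ifs
        exacts [hFm k, MeasurableSet.empty]
      rw [hν _ hU hUm, ← (hsub x' ω).tsum_eq]
      refine tsum_congr fun k => ?_
      split_ifs
      · exact (hν _ (hFI k) (hFm k) x').symm
      · simp) (half_pos hε)
  have h1 := hFint k
  rw [← hν _ (hFI k) (hFm k)] at h1
  have h2 := (y (n k)).le_of_opNorm_le (hy _) (ν (F k))
  rw [Real.norm_eq_abs] at h2
  linarith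

theorem FPettisIntegrable.exists_setLIntegral_enorm_le {f : ℝ → X} (hf : FPettisIntegrable f)
    {ε : ℝ} (hε : 0 < ε) : ∃ η : ℝ≥0∞, 0 < η ∧ ∀ B ⊆ Icc (0:ℝ) 1, MeasurableSet B →
      volume B ≤ η → ∀ y : X →L[ℝ] ℝ, ‖y‖ ≤ 1 →
        ∫⁻ t in B, ‖y (f t)‖ₑ ≤ ENNReal.ofReal ε := by
  obtain ⟨η, hη, hsmall⟩ := hf.exists_abs_setIntegral_le (half_pos hε)
  refine ⟨η, hη, fun B hB hBm hBη y hy => ?_⟩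
  have hint := (hf.1 y).mono_set hB
  obtain ⟨g', hg'm, hgg'⟩ := hint.aemeasurable
  have hPm : MeasurableSet {t | 0 ≤ g' t} := measurableSet_le measurable_const hg'm
  rw [← ofReal_integral_norm_eq_lintegral_enorm hint]
  refine ENNReal.ofReal_le_ofReal ?_
  rw [← integral_inter_add_sdiff hPm hint.norm]
  have h1 : ∫ t in B ∩ {t | 0 ≤ g' t}, ‖y (f t)‖ = ∫ t in B ∩ {t | 0 ≤ g' t}, y (f t) := by
    refine integral_congr_ae ?_
    rw [Filter.EventuallyEq, ae_restrict_iff' (hBm.inter hPm)]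
    filter_upwards [(ae_restrict_iff' hBm).1 hgg'] with t ht htB
    rw [ht htB.1]
    exact Real.norm_of_nonneg htB.2
  have h2 : ∫ t in B \ {t | 0 ≤ g' t}, ‖y (f t)‖ = -∫ t in B \ {t | 0 ≤ g' t}, y (f t) := by
    rw [← integral_neg]
    refine integral_congr_ae ?_
    rw [Filter.EventuallyEq, ae_restrict_iff' (hBm.diff hPm)]
    filter_upwards [(ae_restrict_iff' hBm).1 hgg'] with t ht htB
    rw [ht htB.1]
    exact Real.norm_of_nonpos (not_le.1 htB.2).le
  have h3 := hsmall _ (inter_subset_left.trans hB) (hBm.inter hPm)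
    ((measure_mono inter_subset_left).trans hBη) y hy
  have h4 := hsmall _ (sdiff_subset.trans hB) (hBm.diff hPm)
    ((measure_mono sdiff_subset).trans hBη) y hy
  rw [h1, h2]
  linarith [(abs_le.1 h3).2, (abs_le.1 h4).1]

/-! ### Birkhoff integrability -/

theorem TP.pt_mem {n : ℕ} (P : TP n) (i : Fin (n + 1)) : P.pt i ∈ Icc (0:ℝ) 1 :=
  ⟨P.first ▸ P.mono (Fin.zero_le i), P.last ▸ P.mono (Fin.le_last i)⟩

theorem TP.ivl_subset {n : ℕ} (P : TP n) (i : Fin n) : P.ivl i ⊆ Icc (0:ℝ) 1 :=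
  Icc_subset_Icc (P.pt_mem _).1 (P.pt_mem _).2

theorem TP.setIntegral_eq_sum {n : ℕ} (P : TP n) {g : ℝ → ℝ}
    (hg : IntegrableOn g (Icc (0:ℝ) 1) volume) :
    ∫ s in Icc (0:ℝ) 1, g s = ∑ i : Fin n, ∫ s in Ioc (P.pt i.castSucc) (P.pt i.succ), g s := by
  let a : ℕ → ℝ := fun k => P.pt ⟨min k n, by omega⟩
  have ha : ∀ i : Fin n, a i = P.pt i.castSucc := fun i =>
    congrArg P.pt (Fin.ext (min_eq_left i.2.le))
  have ha' : ∀ i : Fin n, a (i + 1) = P.pt i.succ := fun i =>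
    congrArg P.pt (Fin.ext (min_eq_left i.2))
  have h := intervalIntegral.sum_integral_adjacent_intervals (μ := volume) (f := g) (a := a)
    (n := n) fun k _ => ((intervalIntegrable_iff_integrableOn_Icc_of_le zero_le_one).2 hg).mono_set
      (by
        rw [uIcc_of_le zero_le_one]
        exact ordConnected_Icc.uIcc_subset (P.pt_mem _) (P.pt_mem _))
  have h0 : a 0 = 0 := (congrArg P.pt (Fin.ext (by simp))).trans P.first
  have hn : a n = 1 := (congrArg P.pt (Fin.ext (by simp))).trans P.last
  rw [h0, hn, intervalIntegral.integral_of_le zero_le_one, ← Fin.sum_univ_eq_sum_range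
    (fun k => ∫ x in a k..a (k + 1), g x)] at h
  rw [integral_Icc_eq_integral_Ioc, ← h]
  refine Finset.sum_congr rfl fun i _ => ?_
  rw [ha, ha', intervalIntegral.integral_of_le (P.mono i.castSucc_lt_succ.le)]

theorem TP.sum_setLIntegral_le {n : ℕ} (P : TP n) (h : ℝ → ℝ≥0∞) :
    ∑ i : Fin n, ∫⁻ s in Ioc (P.pt i.castSucc) (P.pt i.succ), h s ≤
      ∫⁻ s in Icc (0:ℝ) 1, h s := by
  have hd : Pairwise (Function.onFun Disjoint
      fun i : Fin n => Ioc (P.pt i.castSucc) (P.pt i.succ)) := by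
    refine (pairwise_disjoint_on _).2 fun i j hij => disjoint_left.2 fun s hi hj => ?_
    have : P.pt i.succ ≤ P.pt j.castSucc := P.mono (by
      rw [Fin.le_def]
      simpa using hij)
    exact absurd (hi.2.trans this) (not_le.2 hj.1)
  rw [← tsum_fintype (L := .unconditional _), ← lintegral_iUnion (fun i => measurableSet_Ioc) hd]
  exact lintegral_mono_set (iUnion_subset fun i => Ioc_subset_Icc_self.trans (P.ivl_subset i))

/-- If the oscillation of `g` around the tags is controlled by `h`, then the Riemann sum is
within `∫ h` of the integral. -/
theorem TP.enorm_setIntegral_sub_fSum_le {n : ℕ} (P : TP n) {g : ℝ → ℝ} {h : ℝ → ℝ≥0∞}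
    (hg : IntegrableOn g (Icc (0:ℝ) 1) volume)
    (hgh : ∀ i, ∀ s ∈ P.ivl i, edist (g (P.tag i)) (g s) ≤ h s) :
    ‖(∫ s in Icc (0:ℝ) 1, g s) - fSum P g‖ₑ ≤ ∫⁻ s in Icc (0:ℝ) 1, h s := by
  have hI : ∀ i : Fin n, Ioc (P.pt i.castSucc) (P.pt i.succ) ⊆ P.ivl i :=
    fun i => Ioc_subset_Icc_self
  have heq : (∫ s in Icc (0:ℝ) 1, g s) - fSum P g =
      ∑ i : Fin n, ∫ s in Ioc (P.pt i.castSucc) (P.pt i.succ), (g s - g (P.tag i)) := by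
    rw [P.setIntegral_eq_sum hg, fSum, ← Finset.sum_sub_distrib]
    refine Finset.sum_congr rfl fun i _ => ?_
    rw [integral_sub (hg.mono_set ((hI i).trans (P.ivl_subset i))) (integrable_const _),
      setIntegral_const, Real.volume_real_Ioc_of_le (P.mono i.castSucc_lt_succ.le)]
    rfl
  rw [heq]
  refine (enorm_sum_le _ _).trans (le_trans (Finset.sum_le_sum fun i _ => ?_)
    (P.sum_setLIntegral_le h))
  refine (enorm_integral_le_lintegral_enorm _).trans ?_
  refine setLIntegral_mono' measurableSet_Ioc fun s hs => ?_
  rw [← edist_eq_enorm_sub, edist_comm]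
  exact hgh i s (hI i hs)

theorem measurable_infDist_of_index (V : ℕ × ℕ → Set ℝ) :
    Measurable fun p : (ℕ × ℕ) × ℝ => infDist p.2 (V p.1) :=
  measurable_from_prod_countable_right fun j => (continuous_infDist_pt (V j)).measurable

/-- The pieces of a countable measurable partition of `[0,1]` can be enlarged to open sets with
arbitrarily small weighted excess. -/
theorem exists_isOpen_cover {idx : ℝ → ℕ × ℕ} (hidx : AEMeasurable idx volume) {M : ℕ × ℕ → ℝ}
    (hM : ∀ j, 0 < M j) {κ : ℝ≥0∞} (hκ : 0 < κ) : ∃ U D : ℕ × ℕ → Set ℝ,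
      (∀ j, IsOpen (U j)) ∧ (∀ j, (U j)ᶜ.Nonempty) ∧ (∀ t ∈ Icc (0:ℝ) 1, t ∈ U (idx t)) ∧
      (∀ j, MeasurableSet (D j)) ∧ (∀ j, ∀ s ∈ U j, idx s ≠ j → s ∈ D j) ∧
      ∑' j, ENNReal.ofReal (M j) * volume (D j) ≤ κ := by
  obtain ⟨r, hr, hrsum⟩ := ENNReal.exists_pos_sum_of_countable' hκ.ne' (ℕ × ℕ)
  have hM0 : ∀ j, ENNReal.ofReal (M j) ≠ 0 := fun j => (ENNReal.ofReal_pos.2 (hM j)).ne'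
  let C : ℕ × ℕ → Set ℝ := fun j => Icc (0:ℝ) 1 ∩ idx ⁻¹' {j}
  have hCm : ∀ j, NullMeasurableSet (C j) volume := fun j =>
    measurableSet_Icc.nullMeasurableSet.inter
      (hidx.nullMeasurable (measurableSet_singleton j))
  have hCfin : ∀ j, volume (C j) ≠ ⊤ := fun j =>
    ((measure_mono inter_subset_left).trans_lt (by simp)).ne
  have hUex := fun j => (C j).exists_isOpen_le_add volume
    (ENNReal.div_pos (hr j).ne' (ENNReal.ofReal_ne_top (r := M j))).ne'
  choose U hCU hUo hUv using hUex
  have hrfin : ∀ j, r j ≠ ⊤ := fun j =>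
    ((ENNReal.le_tsum j).trans_lt (hrsum.trans_le le_top)).ne
  have hUfin : ∀ j, volume (U j) ≠ ⊤ := fun j => ne_top_of_le_ne_top
    (ENNReal.add_ne_top.2 ⟨hCfin j, (ENNReal.div_lt_top (hrfin j) (hM0 j)).ne⟩) (hUv j)
  refine ⟨U, fun j => toMeasurable volume (U j \ C j), hUo, fun j => ?_, fun t ht => ?_,
    fun j => measurableSet_toMeasurable _ _, fun j s hs hsj => ?_, ?_⟩
  · rw [nonempty_compl]
    intro h
    exact hUfin j (by rw [h]; exact Real.volume_univ)
  · exact hCU _ ⟨ht, rfl⟩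
  · exact subset_toMeasurable _ _ ⟨hs, fun h => hsj h.2⟩
  · refine (ENNReal.tsum_le_tsum fun j => ?_).trans hrsum.le
    have : volume (toMeasurable volume (U j \ C j)) ≤ r j / ENNReal.ofReal (M j) := by
      rw [measure_toMeasurable, measure_sdiff (hCU j) (hCm j) (hCfin j)]
      exact tsub_le_iff_left.2 (hUv j)
    rw [mul_comm]
    exact (ENNReal.le_div_iff_mul_le (Or.inl (hM0 j)) (Or.inl ENNReal.ofReal_ne_top)).1 this

/-- A family of open sets with proper members determines a measurable gauge. -/
theorem exists_gauge_of_isOpen {idx : ℝ → ℕ × ℕ} (hidx : AEMeasurable idx volume)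
    {U : ℕ × ℕ → Set ℝ} (hUo : ∀ j, IsOpen (U j)) (hUne : ∀ j, (U j)ᶜ.Nonempty)
    (hU : ∀ t ∈ Icc (0:ℝ) 1, t ∈ U (idx t)) : ∃ δ : ℝ → ℝ, IsGauge δ ∧ AEMeasurable δ volume ∧
      ∀ (n : ℕ) (P : TP n), P.IsFine δ → ∀ i, P.ivl i ⊆ U (idx (P.tag i)) := by
  refine ⟨fun t => infDist t (U (idx t))ᶜ, fun t ht => ?_, ?_, fun n P hP i s hs => ?_⟩
  · have h : t ∉ (U (idx t))ᶜ := fun h => h (hU t ht)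
    exact ((hUo (idx t)).isClosed_compl.notMem_iff_infDist_pos (hUne (idx t))).1 h
  · have h : AEMeasurable (fun t => (idx t, t)) volume := hidx.prodMk aemeasurable_id
    have hV : Measurable fun p : (ℕ × ℕ) × ℝ => infDist p.2 (U p.1)ᶜ :=
      measurable_infDist_of_index fun j => (U j)ᶜ
    have hc := hV.comp_aemeasurable h
    exact hc
  · have h1 := hP i hs
    rw [← Real.ball_eq_Ioo] at h1
    exact ball_infDist_compl_subset h1

/-- A Pettis integrable `ℋ`-integrable function is Birkhoff integrable. -/
theorem FPettisIntegrable.fBirkhoffIntegrable {f : ℝ → X} (hf : FPettisIntegrable f)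
    (hH : FHMeasIntegrable f) : FBirkhoffIntegrable f := by
  obtain ⟨w, hw⟩ := hf.2 _ subset_rfl measurableSet_Icc.nullMeasurableSet
  refine ⟨w, fun ε hε => ?_⟩
  obtain ⟨e, he, heε⟩ : ∃ e : ℝ, 0 < e ∧ 3 * e < ε := ⟨ε / 4, by positivity, by linarith⟩
  obtain ⟨η, hη, hUI⟩ := hf.exists_setLIntegral_enorm_le he
  obtain ⟨idx, hidx, hbdd, hosc⟩ := hH.exists_index he
  have hbdd' : ∀ j, ∃ M : ℝ, 1 ≤ M ∧ ∀ t ∈ Icc (0:ℝ) 1, idx t = j → ‖f t‖ ≤ M := fun j => by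
    obtain ⟨M, hM⟩ := hbdd j
    exact ⟨max M 1, le_max_right _ _, fun t ht h => (hM t ht h).trans (le_max_left _ _)⟩
  choose M hM1 hM using hbdd'
  have hMle : ∀ j, 1 ≤ ENNReal.ofReal (M j) := fun j => by
    rw [← ENNReal.ofReal_one]
    exact ENNReal.ofReal_le_ofReal (hM1 j)
  obtain ⟨U, D, hUo, hUne, hU, hDm, hUD, hDsum⟩ := exists_isOpen_cover hidx
    (fun j => one_pos.trans_le (hM1 j)) (lt_min (ENNReal.ofReal_pos.2 he) hη)
  obtain ⟨δ, hδ, hδm, hPU⟩ := exists_gauge_of_isOpen hidx hUo hUne hU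
  obtain ⟨m, hmm, hmD, hmint⟩ : ∃ m : ℝ → ℝ≥0∞, Measurable m ∧
      (∀ j, ∀ s ∈ D j, ENNReal.ofReal (M j) ≤ m s) ∧
      ∫⁻ s in Icc (0:ℝ) 1, m s ≤ ENNReal.ofReal e := by
    refine ⟨fun s => ∑' j, (D j).indicator (fun _ => ENNReal.ofReal (M j)) s,
      Measurable.tsum fun j => measurable_const.indicator (hDm j), fun j s hs => ?_, ?_⟩
    · refine le_trans ?_ (ENNReal.le_tsum j)
      rw [indicator_of_mem hs]
    · refine (setLIntegral_le_lintegral _ _).trans ?_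
      rw [lintegral_tsum fun j => (measurable_const.indicator (hDm j)).aemeasurable]
      simp_rw [lintegral_indicator_const (hDm _)]
      exact hDsum.trans (min_le_left _ _)
  obtain ⟨B, hBI, hBm, hDB, hBη⟩ : ∃ B ⊆ Icc (0:ℝ) 1, MeasurableSet B ∧
      (∀ j, ∀ s ∈ Icc (0:ℝ) 1, s ∈ D j → s ∈ B) ∧ volume B ≤ η := by
    refine ⟨Icc (0:ℝ) 1 ∩ ⋃ j, D j, inter_subset_left,
      measurableSet_Icc.inter (MeasurableSet.iUnion hDm),
      fun j s hs hsD => ⟨hs, mem_iUnion.2 ⟨j, hsD⟩⟩, ?_⟩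
    refine (measure_mono inter_subset_right).trans ((measure_iUnion_le _).trans ?_)
    refine (ENNReal.tsum_le_tsum fun j => ?_).trans (hDsum.trans (min_le_right _ _))
    exact le_mul_of_one_le_left' (hMle j)
  refine ⟨δ, hδ, hδm, fun n P hP => ?_⟩
  obtain ⟨y, hy, hyw⟩ := exists_dual_vector'' ℝ (w - fSum P f)
  have hkey := P.enorm_setIntegral_sub_fSum_le (g := fun t => y (f t))
    (h := fun s => oscOn f idx y (idx s) + m s + B.indicator (fun s => ‖y (f s)‖ₑ) s) (hf.1 y)
    (fun i s hs => by
      have hsI := P.ivl_subset i hs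
      by_cases hst : idx (P.tag i) = idx s
      · rw [add_assoc]
        have h := edist_le_oscOn (f := f) (y := y) (P.tagMem i) hsI hst
        exact h.trans le_self_add
      · have hsD := hUD _ s (hPU n P hP i hs) (Ne.symm hst)
        rw [indicator_of_mem (hDB _ s hsI hsD), edist_eq_enorm_sub]
        refine enorm_sub_le.trans (add_le_add (le_trans ?_ le_add_self) le_rfl)
        refine le_trans ?_ (hmD _ s hsD)
        rw [← ofReal_norm]
        refine ENNReal.ofReal_le_ofReal ((y.le_of_opNorm_le hy _).trans ?_)
        rw [one_mul]
        exact hM _ _ (P.tagMem i) rfl)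
  have hoscm : AEMeasurable (fun s => oscOn f idx y (idx s)) (volume.restrict (Icc (0:ℝ) 1)) :=
    (measurable_of_countable (oscOn f idx y)).comp_aemeasurable hidx.restrict
  have hsm : AEMeasurable (fun s => oscOn f idx y (idx s) + m s)
      (volume.restrict (Icc (0:ℝ) 1)) := hoscm.add hmm.aemeasurable
  rw [lintegral_add_left' hsm, lintegral_add_left' hoscm,
    lintegral_indicator hBm, Measure.restrict_restrict hBm,
    inter_eq_self_of_subset_left hBI] at hkey
  have hle : ‖(∫ s in Icc (0:ℝ) 1, y (f s)) - fSum P fun t => y (f t)‖ₑ ≤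
      ENNReal.ofReal (3 * e) := by
    refine hkey.trans ((add_le_add (add_le_add (hosc y hy) hmint)
      (hUI B hBI hBm hBη y hy)).trans ?_)
    rw [← ENNReal.ofReal_add he.le he.le, ← ENNReal.ofReal_add (by positivity) he.le]
    exact ENNReal.ofReal_le_ofReal (by linarith)
  rw [← ofReal_norm, ENNReal.ofReal_le_ofReal_iff (by positivity), ← hw y] at hle
  have hsum : y (fSum P f) = fSum P fun t => y (f t) := by
    simp [fSum, map_sum, map_smul]
  rw [← hsum, ← map_sub, hyw] at hle
  simp only [RCLike.ofReal_real_eq_id, id, norm_norm] at hle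
  linarith

/-- Proposition `p10` of the paper. Every `ℋ`-integrable multifunction
`Γ : [0,1] → cwk(X)` admits an `ℋ`-integrable selection; if moreover `Γ` is Pettis
integrable, then it admits a Birkhoff integrable selection. -/
theorem HMeas_selection_exists
    {X : Type*} [NormedAddCommGroup X] [NormedSpace ℝ X] [CompleteSpace X]
    (Γ : ℝ → Set X) (hΓ : ∀ t ∈ Icc (0:ℝ) 1, IsCWK X (Γ t)) :
    (HMeasIntegrable Γ → ∃ f : ℝ → X, Selection Γ f ∧ FHMeasIntegrable f) ∧
    (PettisIntegrable Γ → HMeasIntegrable Γ →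
      ∃ f : ℝ → X, Selection Γ f ∧ FBirkhoffIntegrable f) := by
  refine ⟨exists_selection_fHMeasIntegrable hΓ, fun hP hH => ?_⟩
  obtain ⟨f, hs, hf⟩ := exists_selection_fHMeasIntegrable hΓ hH
  exact ⟨f, hs, (hf.fPettisIntegrable_of_selection hΓ hP hs).fBirkhoffIntegrable hf⟩

end GaugePaper
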